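/- Littlewood–Richardson rule for factorial Schur functions: s_λ(x|y)·s_μ(x|y) = Σ c_{λ*B} · s_{λ+ω(B^u)}(x|y), the sum over all reverse barred tableaux B of shape μ such that the unbarred column word of λ*B is Yamanouchi. -/

import Mathlib

open scoped Classical
open MvPolynomial

noncomputable section

namespace EqLR

/-- Ambient polynomial ring `ℂ[x_1,…,x_d ; y_i (i ∈ ℤ)]`.
The variables `x_j` are indexed by `Fin d` (so `x_{j+1} = X (Sum.inl j)`), and the
variables `y_i` are indexed by `ℤ` (only positive indices actually occur). -/
abbrev P (d : ℕ) := MvPolynomial (Fin d ⊕ ℤ) ℂ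

/-- The variable `y_i`. -/
def yI (d : ℕ) (i : ℤ) : P d := X (Sum.inr i)

/-- The variable `x_v` for a value `v ∈ {1,…,d}` (junk value `0` otherwise). -/
def xv (d : ℕ) (v : ℕ) : P d :=
  if h : v - 1 < d then X (Sum.inl ⟨v - 1, h⟩) else 0

/-- The component `ξ_v` of a vector `ξ ∈ ℕ^d`, for a (1-based) value `v ∈ {1,…,d}`. -/
def vecAt {d : ℕ} (ξ : Fin d → ℕ) (v : ℕ) : ℕ :=
  if h : v - 1 < d then ξ ⟨v - 1, h⟩ else 0

/-- `μ ∈ ℕ^d` is a partition:  `μ_1 ≥ μ_2 ≥ … ≥ μ_d`. -/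
def IsPartitionVec {d : ℕ} (μ : Fin d → ℕ) : Prop :=
  ∀ i j : Fin d, i ≤ j → μ j ≤ μ i

/-- `|μ| = μ_1 + ⋯ + μ_d`. -/
def wt {d : ℕ} (μ : Fin d → ℕ) : ℕ := ∑ i, μ i

/-- `ρ = (d-1, d-2, …, 0)`. -/
def rho (d : ℕ) : Fin d → ℕ := fun i => d - 1 - (i : ℕ)

/-- Cells `(r, c)` (both 0-based) of the Young/reverse Young diagram whose row `r` has
length `μ_{r+1}`.  For the reverse diagram, rows are numbered bottom-to-top and columns
right-to-left; for the ordinary Young diagram, top-to-bottom and left-to-right. -/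
def cells (d : ℕ) (μ : Fin d → ℕ) : Finset (ℕ × ℕ) :=
  (Finset.range d ×ˢ Finset.range (Finset.univ.sup μ + 1)).filter
    fun rc => ∃ h : rc.1 < d, rc.2 < μ ⟨rc.1, h⟩

/-- In the column reading word of a *reverse* diagram (columns right-to-left, i.e. in
increasing 0-based column index, each column read top-to-bottom, i.e. in decreasing
0-based row index), the cell `b` is read strictly before the cell `a`. -/
def revBefore (a b : ℕ × ℕ) : Prop := b.2 < a.2 ∨ (b.2 = a.2 ∧ a.1 < b.1)

/-- In the column reading word of an ordinary Young diagram (rightmost column first,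
each column read top-to-bottom), the cell `b` is read strictly before the cell `a`. -/
def youngBefore (a b : ℕ × ℕ) : Prop := a.2 < b.2 ∨ (b.2 = a.2 ∧ b.1 < a.1)

/-- A reverse tableau of shape `μ`: entries in `{1,…,d}`, weakly increasing along rows
(left to right) and strictly increasing down columns (top to bottom). -/
structure RevTableau (d : ℕ) (μ : Fin d → ℕ) where
  val : ℕ × ℕ → ℕ
  mem : ∀ a ∈ cells d μ, 1 ≤ val a ∧ val a ≤ d
  zero : ∀ a ∉ cells d μ, val a = 0
  row : ∀ r c : ℕ, (r, c + 1) ∈ cells d μ → val (r, c + 1) ≤ val (r, c)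
  col : ∀ r c : ℕ, (r + 1, c) ∈ cells d μ → val (r + 1, c) < val (r, c)

/-- The factor `x_v - y_{(d+1-v) + c(a) - r(a)}` attached to an entry of value `v` in
the cell `a` of the reverse diagram (`c(a) = a.2 + 1`, `r(a) = a.1 + 1`, 1-based). -/
def factor (d : ℕ) (v : ℕ) (a : ℕ × ℕ) : P d :=
  xv d v - yI d ((d : ℤ) + 1 - (v : ℤ) + (a.2 : ℤ) - (a.1 : ℤ))

/-- The factorial Schur function `s_μ(x|y) = Σ_R (x|y)^R`. -/
def fSchur (d : ℕ) (μ : Fin d → ℕ) : P d :=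
  ∑ᶠ R : RevTableau d μ, ∏ a ∈ cells d μ, factor d (R.val a) a

/-- The ordinary Schur function `s_μ(x) = Σ_R x^R`. -/
def schurX (d : ℕ) (μ : Fin d → ℕ) : P d :=
  ∑ᶠ R : RevTableau d μ, ∏ a ∈ cells d μ, xv d (R.val a)

/-- The subalgebra `ℂ[y]` of polynomials in the `y` variables only. -/
def ySub (d : ℕ) : Subalgebra ℂ (P d) :=
  Algebra.adjoin ℂ (Set.range fun i : ℤ => yI d i)

/-- `p` is symmetric in the `x` variables. -/
def SymmX {d : ℕ} (p : P d) : Prop :=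
  ∀ σ : Equiv.Perm (Fin d), rename (⇑(Equiv.sumCongr σ (Equiv.refl ℤ))) p = p

/-- The falling factorial power `(x_j | y)^k = (x_j - y_1)⋯(x_j - y_k)`. -/
def ffPow (d : ℕ) (j : Fin d) (k : ℕ) : P d :=
  ∏ i ∈ Finset.range k, (X (Sum.inl j) - yI d ((i : ℤ) + 1))

/-- `(x|y)^ξ = (x_1|y)^{ξ_1} ⋯ (x_d|y)^{ξ_d}`. -/
def xyPow (d : ℕ) (ξ : Fin d → ℕ) : P d := ∏ j : Fin d, ffPow d j (ξ j)

/-- The alternant `a_ξ(x|y) = det[(x_j|y)^{ξ_i}]`. -/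
def aDet (d : ℕ) (ξ : Fin d → ℕ) : P d :=
  Matrix.det (Matrix.of fun i j : Fin d => ffPow d j (ξ i))

/-! ### Skew barred tableaux of shape `λ*μ` -/

/-- A skew barred tableau of shape `λ*μ`: the Young diagram `λ` (placed above and to
the right of the reverse diagram `μ`) is filled with values in `{1,…,d}` (field `top`),
the reverse diagram `μ` is filled with values in `{1,…,d}` (field `bot`), some of whose
cells may be barred (field `barred`); values weakly increase along rows left-to-right
and strictly increase down columns, ignoring bars. -/
structure SkewBarredTableau (d : ℕ) (lam mu : Fin d → ℕ) where
  top : ℕ × ℕ → ℕ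
  bot : ℕ × ℕ → ℕ
  barred : ℕ × ℕ → Prop
  top_mem : ∀ a ∈ cells d lam, 1 ≤ top a ∧ top a ≤ d
  top_zero : ∀ a ∉ cells d lam, top a = 0
  bot_mem : ∀ a ∈ cells d mu, 1 ≤ bot a ∧ bot a ≤ d
  bot_zero : ∀ a ∉ cells d mu, bot a = 0
  barred_sub : ∀ a, barred a → a ∈ cells d mu
  top_row : ∀ r c : ℕ, (r, c + 1) ∈ cells d lam → top (r, c) ≤ top (r, c + 1)
  top_col : ∀ r c : ℕ, (r + 1, c) ∈ cells d lam → top (r, c) < top (r + 1, c)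
  bot_row : ∀ r c : ℕ, (r, c + 1) ∈ cells d mu → bot (r, c + 1) ≤ bot (r, c)
  bot_col : ∀ r c : ℕ, (r + 1, c) ∈ cells d mu → bot (r + 1, c) < bot (r, c)

namespace SkewBarredTableau

variable {d : ℕ} {lam mu : Fin d → ℕ}

/-- `ω(L^u_{<a})_k`: the number of `k`'s among the unbarred entries of `L` read strictly
before the `μ`-cell `a` in the unbarred column word (all of `λ` is read before `μ`). -/
def countBefore (L : SkewBarredTableau d lam mu) (a : ℕ × ℕ) (k : ℕ) : ℕ :=
  ((cells d lam).filter fun b => L.top b = k).card +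
  ((cells d mu).filter fun b => ¬ L.barred b ∧ L.bot b = k ∧ revBefore a b).card

/-- `ω(L^u_{≤a})_k`: as `countBefore`, but the entry of `a` itself is also counted when
`a` is unbarred. -/
def countUpTo (L : SkewBarredTableau d lam mu) (a : ℕ × ℕ) (k : ℕ) : ℕ :=
  ((cells d lam).filter fun b => L.top b = k).card +
  ((cells d mu).filter fun b => ¬ L.barred b ∧ L.bot b = k ∧ (revBefore a b ∨ b = a)).card

/-- Prefix content within the `λ`-part of the word. -/
def topCountUpTo (L : SkewBarredTableau d lam mu) (a : ℕ × ℕ) (k : ℕ) : ℕ :=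
  ((cells d lam).filter fun b => L.top b = k ∧ (youngBefore a b ∨ b = a)).card

/-- `ω(L^u)_k`: total content of the unbarred column word of `L`. -/
def content (L : SkewBarredTableau d lam mu) (k : ℕ) : ℕ :=
  ((cells d lam).filter fun b => L.top b = k).card +
  ((cells d mu).filter fun b => ¬ L.barred b ∧ L.bot b = k).card

/-- The unbarred column word of `L` is Yamanouchi: every prefix contains at least as
many `k`'s as `(k+1)`'s, for every `k ≥ 1`. -/
def Yamanouchi (L : SkewBarredTableau d lam mu) : Prop :=
  (∀ a ∈ cells d lam, ∀ k : ℕ, 1 ≤ k → L.topCountUpTo a (k + 1) ≤ L.topCountUpTo a k) ∧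
  (∀ a ∈ cells d mu, ¬ L.barred a → ∀ k : ℕ, 1 ≤ k →
      L.countUpTo a (k + 1) ≤ L.countUpTo a k)

/-- `L` is an equivariant Littlewood–Richardson skew tableau of shape `λ*μ` and unbarred
content `ν`. -/
def IsLR (L : SkewBarredTableau d lam mu) (ν : Fin d → ℕ) : Prop :=
  L.Yamanouchi ∧ ∀ i : Fin d, L.content ((i : ℕ) + 1) = ν i

/-- The index `|a|' + ω(L^u_{<a})_{|a|}` of the first `y` in the factor of `c_L` at a
barred cell `a`. -/
def eIdx (L : SkewBarredTableau d lam mu) (a : ℕ × ℕ) : ℤ :=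
  ((d : ℤ) + 1 - (L.bot a : ℤ)) + (L.countBefore a (L.bot a) : ℤ)

/-- The index `|a|' + c(a) - r(a)` of the second `y` in the factor of `c_L` at a barred
cell `a`. -/
def fIdx (L : SkewBarredTableau d lam mu) (a : ℕ × ℕ) : ℤ :=
  ((d : ℤ) + 1 - (L.bot a : ℤ)) + (a.2 : ℤ) - (a.1 : ℤ)

/-- The weight `c_L = ∏_{a barred} (y_{|a|'+ω(L^u_{<a})_{|a|}} - y_{|a|'+c(a)-r(a)})`. -/
def cWt (L : SkewBarredTableau d lam mu) : P d :=
  ∏ a ∈ (cells d mu).filter (fun a => L.barred a), (yI d (L.eIdx a) - yI d (L.fIdx a))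

/-- `Δ(a) = ω(L^u_{≤a})_{|a|} - c(a) + r(a)`. -/
def Δ (L : SkewBarredTableau d lam mu) (a : ℕ × ℕ) : ℤ :=
  (L.countUpTo a (L.bot a) : ℤ) - ((a.2 : ℤ) + 1) + ((a.1 : ℤ) + 1)

end SkewBarredTableau

/-! ### Reverse barred tableaux -/

/-- A reverse barred tableau of shape `μ`. -/
structure RevBarredTableau (d : ℕ) (μ : Fin d → ℕ) where
  val : ℕ × ℕ → ℕ
  barred : ℕ × ℕ → Prop
  mem : ∀ a ∈ cells d μ, 1 ≤ val a ∧ val a ≤ d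
  zero : ∀ a ∉ cells d μ, val a = 0
  barred_sub : ∀ a, barred a → a ∈ cells d μ
  row : ∀ r c : ℕ, (r, c + 1) ∈ cells d μ → val (r, c + 1) ≤ val (r, c)
  col : ∀ r c : ℕ, (r + 1, c) ∈ cells d μ → val (r + 1, c) < val (r, c)

namespace RevBarredTableau

variable {d : ℕ} {μ : Fin d → ℕ}

/-- `ω(B^u_{<a})_k`. -/
def countBefore (B : RevBarredTableau d μ) (a : ℕ × ℕ) (k : ℕ) : ℕ :=
  ((cells d μ).filter fun b => ¬ B.barred b ∧ B.val b = k ∧ revBefore a b).card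

/-- `ω(B^u_{≤a})_k` (including `a` itself when unbarred). -/
def countUpTo (B : RevBarredTableau d μ) (a : ℕ × ℕ) (k : ℕ) : ℕ :=
  ((cells d μ).filter fun b => ¬ B.barred b ∧ B.val b = k ∧ (revBefore a b ∨ b = a)).card

/-- `ω(B^u)_k`. -/
def content (B : RevBarredTableau d μ) (k : ℕ) : ℕ :=
  ((cells d μ).filter fun b => ¬ B.barred b ∧ B.val b = k).card

/-- `e_{ξ,B}(a) = (ξ + ω(B^u_{<a}))_{|a|}`. -/
def eIdx (B : RevBarredTableau d μ) (ξ : Fin d → ℕ) (a : ℕ × ℕ) : ℤ :=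
  (vecAt ξ (B.val a) : ℤ) + (B.countBefore a (B.val a) : ℤ)

/-- `f_B(a) = |a|' + c(a) - r(a)`. -/
def fIdx (B : RevBarredTableau d μ) (a : ℕ × ℕ) : ℤ :=
  ((d : ℤ) + 1 - (B.val a : ℤ)) + (a.2 : ℤ) - (a.1 : ℤ)

/-- `c_{ξ,B} = ∏_{a barred} (y_{e_{ξ,B}(a)} - y_{f_B(a)})`. -/
def cXi (B : RevBarredTableau d μ) (ξ : Fin d → ℕ) : P d :=
  ∏ a ∈ (cells d μ).filter (fun a => B.barred a), (yI d (B.eIdx ξ a) - yI d (B.fIdx a))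

/-- The unbarred column word of `λ*B` is Yamanouchi (the `λ`-part is the canonical
filling of `λ`, whose whole content `λ` is added to every prefix of `B^u`). -/
def StarYam (B : RevBarredTableau d μ) (lam : Fin d → ℕ) : Prop :=
  ∀ a ∈ cells d μ, ¬ B.barred a → ∀ k : ℕ, 1 ≤ k →
    vecAt lam (k + 1) + B.countUpTo a (k + 1) ≤ vecAt lam k + B.countUpTo a k

end RevBarredTableau

/-! ### Reverse hatted tableaux -/

/-- A hat decoration: none, left hat, or right hat. -/
inductive Hat where
  | unhatted : Hat
  | left : Hat
  | right : Hat
deriving DecidableEq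

/-- A reverse hatted tableau of shape `μ`. -/
structure RevHattedTableau (d : ℕ) (μ : Fin d → ℕ) where
  val : ℕ × ℕ → ℕ
  hat : ℕ × ℕ → Hat
  mem : ∀ a ∈ cells d μ, 1 ≤ val a ∧ val a ≤ d
  zero : ∀ a ∉ cells d μ, val a = 0
  hat_out : ∀ a ∉ cells d μ, hat a = Hat.unhatted
  row : ∀ r c : ℕ, (r, c + 1) ∈ cells d μ → val (r, c + 1) ≤ val (r, c)
  col : ∀ r c : ℕ, (r + 1, c) ∈ cells d μ → val (r + 1, c) < val (r, c)

namespace RevHattedTableau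

variable {d : ℕ} {μ : Fin d → ℕ}

/-- `ω(H^u_{<a})_k`: content of the unhatted column word of `H` read before `a`. -/
def countBefore (H : RevHattedTableau d μ) (a : ℕ × ℕ) (k : ℕ) : ℕ :=
  ((cells d μ).filter fun b => H.hat b = Hat.unhatted ∧ H.val b = k ∧ revBefore a b).card

/-- `ω(H^u)_k`. -/
def content (H : RevHattedTableau d μ) (k : ℕ) : ℕ :=
  ((cells d μ).filter fun b => H.hat b = Hat.unhatted ∧ H.val b = k).card

/-- `e_{ξ,H}(a) = (ξ + ω(H^u_{<a}))_{|a|}`. -/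
def eIdx (H : RevHattedTableau d μ) (ξ : Fin d → ℕ) (a : ℕ × ℕ) : ℤ :=
  (vecAt ξ (H.val a) : ℤ) + (H.countBefore a (H.val a) : ℤ)

/-- `f_H(a) = |a|' + c(a) - r(a)`. -/
def fIdx (H : RevHattedTableau d μ) (a : ℕ × ℕ) : ℤ :=
  ((d : ℤ) + 1 - (H.val a : ℤ)) + (a.2 : ℤ) - (a.1 : ℤ)

/-- `d_{ξ,H} = ∏_{a ∈ H^l} y_{e_{ξ,H}(a)} · ∏_{a ∈ H^r} (-y_{f_H(a)})`. -/
def dWt (H : RevHattedTableau d μ) (ξ : Fin d → ℕ) : P d :=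
  (∏ a ∈ (cells d μ).filter (fun a => H.hat a = Hat.left), yI d (H.eIdx ξ a)) *
  ∏ a ∈ (cells d μ).filter (fun a => H.hat a = Hat.right), (-(yI d (H.fIdx a)))

end RevHattedTableau

/-- `H̄ = B`: `H` unbars to the reverse barred tableau `B`. -/
def UnbarsTo {d : ℕ} {μ : Fin d → ℕ} (H : RevHattedTableau d μ)
    (B : RevBarredTableau d μ) : Prop :=
  H.val = B.val ∧ ∀ a, (H.hat a ≠ Hat.unhatted ↔ B.barred a)

/-- The simple transposition `σ_i` on values: exchanges `i` and `i+1`. -/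
def swapVal (i v : ℕ) : ℕ := if v = i then i + 1 else if v = i + 1 then i else v

/-- The action of `σ_i` on `ℕ^d` by permuting coordinates. -/
def swapVec {d : ℕ} (i : ℕ) (ξ : Fin d → ℕ) : Fin d → ℕ :=
  fun j => vecAt ξ (swapVal i ((j : ℕ) + 1))

/-! ### Reverse (barred) subtableaux -/

/-- A reverse subtableau of shape `μ`: each cell is empty (value `0`) or carries a value
in `{1,…,d}`; no row or column conditions. -/
structure RevSubTableau (d : ℕ) (μ : Fin d → ℕ) where
  val : ℕ × ℕ → ℕ
  mem : ∀ a ∈ cells d μ, val a ≤ d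
  zero : ∀ a ∉ cells d μ, val a = 0

/-- A reverse barred subtableau of shape `μ`: a reverse subtableau some of whose filled
cells are barred. -/
structure RevBarredSubTableau (d : ℕ) (μ : Fin d → ℕ) where
  val : ℕ × ℕ → ℕ
  barred : ℕ × ℕ → Prop
  mem : ∀ a ∈ cells d μ, val a ≤ d
  zero : ∀ a ∉ cells d μ, val a = 0
  barred_filled : ∀ a, barred a → a ∈ cells d μ ∧ val a ≠ 0

/-- `(x|y)^R` for a reverse subtableau `R`. -/
def RevSubTableau.xyProd {d : ℕ} {μ : Fin d → ℕ} (R : RevSubTableau d μ) : P d :=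
  ∏ a ∈ (cells d μ).filter (fun a => R.val a ≠ 0), factor d (R.val a) a

namespace RevBarredSubTableau

variable {d : ℕ} {μ : Fin d → ℕ}

/-- `ω(B^u_{<a})_k`: unbarred filled entries of value `k` read before `a`. -/
def countBefore (B : RevBarredSubTableau d μ) (a : ℕ × ℕ) (k : ℕ) : ℕ :=
  ((cells d μ).filter fun b => ¬ B.barred b ∧ B.val b = k ∧ revBefore a b).card

/-- `ω(B^u)_k`. -/
def content (B : RevBarredSubTableau d μ) (k : ℕ) : ℕ :=
  ((cells d μ).filter fun b => ¬ B.barred b ∧ B.val b = k).card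

/-- `e_{ξ,B}(a) = (ξ + ω(B^u_{<a}))_{|a|}`. -/
def eIdx (B : RevBarredSubTableau d μ) (ξ : Fin d → ℕ) (a : ℕ × ℕ) : ℤ :=
  (vecAt ξ (B.val a) : ℤ) + (B.countBefore a (B.val a) : ℤ)

/-- `f_B(a) = |a|' + c(a) - r(a)`. -/
def fIdx (B : RevBarredSubTableau d μ) (a : ℕ × ℕ) : ℤ :=
  ((d : ℤ) + 1 - (B.val a : ℤ)) + (a.2 : ℤ) - (a.1 : ℤ)

/-- `c_{ξ,B}`. -/
def cXi (B : RevBarredSubTableau d μ) (ξ : Fin d → ℕ) : P d :=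
  ∏ a ∈ (cells d μ).filter (fun a => B.barred a), (yI d (B.eIdx ξ a) - yI d (B.fIdx a))

end RevBarredSubTableau

end EqLR

namespace EqLR

/-! ### Columns as finite sets -/

section Columns

variable {d : ℕ}

/-- The number of elements of `S` that are at least `v`. -/
def cnt (S : Finset (Fin d)) (v : ℕ) : ℕ := (S.filter fun j : Fin d => v ≤ (j : ℕ)).card

/-- The column with entry set `S` may stand directly to the left of the column with entry
set `b` (bottom-aligned). -/
def ColLE (S b : Finset (Fin d)) : Prop := ∀ v, cnt S v ≤ cnt b v

/-- The factor of the entry `i` in the `c`-th column with entry set `S`. -/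
def colFactor (c : ℕ) (S : Finset (Fin d)) (i : Fin d) : P d :=
  X (Sum.inl i) - yI d ((d : ℤ) - (i : ℕ) + c - cnt S (i + 1))

/-- The product of the factors of the `c`-th column with entry set `S`. -/
def colWt (c : ℕ) (S : Finset (Fin d)) : P d := ∏ i ∈ S, colFactor c S i

/-- The sum of the weights of all fillings of the columns `c, …, c + n - 1`, where the
`j`-th column has height `h j` and the column before the `c`-th has entry set `b`. -/
def colSum (h : ℕ → ℕ) : ℕ → ℕ → Finset (Fin d) → P d
  | 0, _, _ => 1
  | n + 1, c, b => ∑ S : Finset (Fin d),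
      if S.card = h c ∧ ColLE S b then colWt c S * colSum h n (c + 1) S else 0

theorem cnt_insert {S : Finset (Fin d)} {i : Fin d} (hi : i ∉ S) (v : ℕ) :
    cnt (insert i S) v = cnt S v + if v ≤ (i : ℕ) then 1 else 0 := by
  unfold cnt
  rw [Finset.filter_insert]
  split_ifs with h
  · rw [Finset.card_insert_of_notMem (by simp [hi])]
  · rfl

theorem cnt_eq_cnt_succ (S : Finset (Fin d)) (i : Fin d) :
    cnt S i = cnt S (i + 1) + if i ∈ S then 1 else 0 := by
  unfold cnt
  split_ifs with h
  · rw [← Finset.card_insert_of_notMem (a := i) (by simp)]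
    congr 1
    ext j
    simp only [Finset.mem_filter, Finset.mem_insert, Fin.ext_iff]
    constructor
    · rintro ⟨h1, h2⟩
      by_cases h3 : (j : ℕ) = i
      · exact Or.inl h3
      · exact Or.inr ⟨h1, by omega⟩
    · rintro (h1 | ⟨h1, h2⟩)
      · have : j = i := Fin.ext h1
        subst this
        exact ⟨h, le_rfl⟩
      · exact ⟨h1, by omega⟩
  · rw [add_zero]
    congr 1
    ext j
    simp only [Finset.mem_filter]
    constructor
    · rintro ⟨h1, h2⟩
      have : j ≠ i := fun h3 => h (h3 ▸ h1)
      have : (j : ℕ) ≠ i := fun h3 => this (Fin.ext h3)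
      exact ⟨h1, by omega⟩
    · rintro ⟨h1, h2⟩
      exact ⟨h1, by omega⟩

theorem colLE_insert_iff {a a' : Fin d} (ha : (a' : ℕ) = a + 1) {S b : Finset (Fin d)}
    (h : a ∉ S) (h' : a' ∉ S) (hb : a' ∈ b ∨ a ∉ b) :
    ColLE (insert a' S) b ↔ ColLE (insert a S) b := by
  have h1 := cnt_eq_cnt_succ S a
  have h2 := cnt_eq_cnt_succ S a'
  have h3 := cnt_eq_cnt_succ b a
  have h4 := cnt_eq_cnt_succ b a'
  rw [if_neg h] at h1
  rw [if_neg h'] at h2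
  rw [ha] at h2 h4
  constructor
  · intro H v
    have := H v
    rw [cnt_insert h'] at this
    rw [cnt_insert h]
    split_ifs at * <;> omega
  · intro H v
    rw [cnt_insert h']
    by_cases hv : v = a + 1
    · have H0 := H a
      have H2 := H (a + 1 + 1)
      rw [cnt_insert h] at H0 H2
      subst hv
      split_ifs at * <;> first | omega | tauto
    · have := H v
      rw [cnt_insert h] at this
      split_ifs at * <;> omega

/-- The weight of the entries of `S` other than `a` and `a'`. -/
theorem colWt_insert_left {a : Fin d} {S : Finset (Fin d)} (h : a ∉ S) (c : ℕ) :
    colWt c (insert a S) =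
      (X (Sum.inl a) - yI d ((d : ℤ) - (a : ℕ) + c - cnt S (a + 1))) *
        ∏ i ∈ S, colFactor c (insert a S) i := by
  unfold colWt
  rw [Finset.prod_insert h, colFactor, cnt_insert h]
  simp

theorem prod_colFactor_insert {a a' : Fin d} (ha : (a' : ℕ) = a + 1) {S : Finset (Fin d)}
    (h : a ∉ S) (h' : a' ∉ S) (c : ℕ) :
    ∏ i ∈ S, colFactor c (insert a' S) i = ∏ i ∈ S, colFactor c (insert a S) i := by
  refine Finset.prod_congr rfl fun i hi => ?_
  have : (i : ℕ) ≠ a := fun h3 => h (Fin.ext h3 ▸ hi)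
  rw [colFactor, colFactor, cnt_insert h, cnt_insert h']
  congr 5
  split_ifs <;> omega

/-- The permutation `σ` of the variables `x`. -/
def act (σ : Equiv.Perm (Fin d)) : P d →ₐ[ℂ] P d := rename (Sum.map σ id)

@[simp]
theorem act_x (σ : Equiv.Perm (Fin d)) (i : Fin d) :
    act σ (X (Sum.inl i)) = X (Sum.inl (σ i)) := by
  simp [act]

@[simp]
theorem act_yI (σ : Equiv.Perm (Fin d)) (i : ℤ) : act σ (yI d i) = yI d i := by
  simp [act, yI]

theorem act_act (σ τ : Equiv.Perm (Fin d)) (p : P d) : act σ (act τ p) = act (σ * τ) p := by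
  simp only [act, rename_rename]
  congr 2
  ext (i | i) <;> simp

theorem act_swap_prod_colFactor {a a' : Fin d} {S : Finset (Fin d)}
    (h : a ∉ S) (h' : a' ∉ S) (c : ℕ) (S' : Finset (Fin d)) :
    act (Equiv.swap a a') (∏ i ∈ S, colFactor c S' i) = ∏ i ∈ S, colFactor c S' i := by
  rw [map_prod]
  refine Finset.prod_congr rfl fun i hi => ?_
  have h1 : i ≠ a := fun h3 => h (h3 ▸ hi)
  have h2 : i ≠ a' := fun h3 => h' (h3 ▸ hi)
  simp [colFactor, Equiv.swap_apply_of_ne_of_ne h1 h2]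

theorem sum_finset_eq_sum_pairs {M : Type*} [AddCommMonoid M] {a a' : Fin d} (ha : a ≠ a')
    (g : Finset (Fin d) → M) :
    ∑ S, g S = ∑ S ∈ (Finset.univ \ {a, a'}).powerset,
      (g S + g (insert a S) + g (insert a' S) + g (insert a (insert a' S))) := by
  have h1 : (Finset.univ : Finset (Finset (Fin d))) =
      (insert a (insert a' (Finset.univ \ {a, a'}))).powerset := by
    ext S
    simp only [Finset.mem_univ, true_iff, Finset.mem_powerset]
    intro i _
    simp only [Finset.mem_insert, Finset.mem_sdiff, Finset.mem_univ, true_and,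
      Finset.mem_singleton]
    tauto
  rw [h1, Finset.sum_powerset_insert (by simp [ha]), Finset.sum_powerset_insert (by simp),
    Finset.sum_powerset_insert (by simp)]
  simp only [Finset.sum_add_distrib]
  abel

/-- One summand of `colSum`. -/
def colTerm (h : ℕ → ℕ) (n c : ℕ) (b S : Finset (Fin d)) : P d :=
  if S.card = h c ∧ ColLE S b then colWt c S * colSum h n (c + 1) S else 0

/-- The group of the summands of `colSum` that agree outside of `{a, a'}`. -/
def colGroup (h : ℕ → ℕ) (n c : ℕ) (a a' : Fin d) (b S : Finset (Fin d)) : P d :=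
  colTerm h n c b S + colTerm h n c b (insert a S) + colTerm h n c b (insert a' S) +
    colTerm h n c b (insert a (insert a' S))

theorem colSum_succ_eq_sum_colGroup (h : ℕ → ℕ) (n c : ℕ) {a a' : Fin d} (ha : a ≠ a')
    (b : Finset (Fin d)) :
    colSum h (n + 1) c b =
      ∑ S ∈ (Finset.univ \ {a, a'}).powerset, colGroup h n c a a' b S := by
  rw [colSum, sum_finset_eq_sum_pairs ha]
  rfl

/-- The invariance of `colSum` under exchanging two neighbouring variables, together with the
divided difference relation on which its inductive proof rests. -/
structure SwapInv (h : ℕ → ℕ) (n c : ℕ) (a a' : Fin d) : Prop where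
  inv : ∀ b : Finset (Fin d), (a' ∈ b ∨ a ∉ b) →
    act (Equiv.swap a a') (colSum h n c b) = colSum h n c b
  rel : ∀ b : Finset (Fin d), a ∉ b → a' ∉ b →
    (X (Sum.inl a') - X (Sum.inl a)) * colSum h n c (insert a' b) =
      (X (Sum.inl a') - yI d ((d : ℤ) - (a' : ℕ) + c - cnt b (a' + 1))) *
          act (Equiv.swap a a') (colSum h n c (insert a b)) -
        (X (Sum.inl a) - yI d ((d : ℤ) - (a' : ℕ) + c - cnt b (a' + 1))) *
          colSum h n c (insert a b)

theorem colTerm_insert_left (h : ℕ → ℕ) (n c : ℕ) {a : Fin d} {b S : Finset (Fin d)}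
    (hS : a ∉ S) :
    colTerm h n c b (insert a S) =
      if S.card + 1 = h c ∧ ColLE (insert a S) b then
        (X (Sum.inl a) - yI d ((d : ℤ) - (a : ℕ) + c - cnt S (a + 1))) *
          (∏ i ∈ S, colFactor c (insert a S) i) * colSum h n (c + 1) (insert a S)
      else 0 := by
  rw [colTerm, Finset.card_insert_of_notMem hS, colWt_insert_left hS]

theorem act_colTerm_of_notMem {h : ℕ → ℕ} {n c : ℕ} {a a' : Fin d}
    (H : SwapInv h n (c + 1) a a') {b S : Finset (Fin d)} (hS : a ∉ S) (hS' : a' ∉ S) :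
    act (Equiv.swap a a') (colTerm h n c b S) = colTerm h n c b S := by
  unfold colTerm
  split_ifs
  · rw [map_mul, H.inv _ (Or.inr hS), colWt, act_swap_prod_colFactor hS hS']
  · exact map_zero _

theorem act_colTerm_insert_insert {h : ℕ → ℕ} {n c : ℕ} {a a' : Fin d}
    (ha : (a' : ℕ) = a + 1) (H : SwapInv h n (c + 1) a a') {b S : Finset (Fin d)}
    (hS : a ∉ S) (hS' : a' ∉ S) :
    act (Equiv.swap a a') (colTerm h n c b (insert a (insert a' S))) =
      colTerm h n c b (insert a (insert a' S)) := by
  have hne : a ≠ a' := fun h => by simp [h] at ha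
  unfold colTerm
  split_ifs
  · have h1 := cnt_eq_cnt_succ S a'
    rw [if_neg hS'] at h1
    rw [map_mul, H.inv _ (Or.inl (by simp)), colWt,
      Finset.prod_insert (by simp [hS, hne]), Finset.prod_insert hS', map_mul, map_mul,
      act_swap_prod_colFactor hS hS']
    simp only [colFactor, map_sub, act_x, act_yI, Equiv.swap_apply_left,
      Equiv.swap_apply_right]
    rw [cnt_insert (by simp [hS, hne]), cnt_insert hS', cnt_insert (by simp [hS, hne]),
      cnt_insert hS', if_pos (show (a : ℕ) + 1 ≤ a' by omega),
      if_neg (show ¬ (a : ℕ) + 1 ≤ a by omega), if_neg (show ¬ (a' : ℕ) + 1 ≤ a' by omega),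
      if_neg (show ¬ (a' : ℕ) + 1 ≤ a by omega)]
    have h2 : ((d : ℤ) - (a : ℕ) + c - ((cnt S (a + 1) + 1 + 0 : ℕ) : ℤ)) =
        (d : ℤ) - (a' : ℕ) + c - ((cnt S (a' + 1) + 0 + 0 : ℕ) : ℤ) := by
      rw [ha] at h1 ⊢
      push_cast
      omega
    rw [h2]
    ring
  · exact map_zero _

theorem act_colTerm_pair {h : ℕ → ℕ} {n c : ℕ} {a a' : Fin d}
    (ha : (a' : ℕ) = a + 1) (H : SwapInv h n (c + 1) a a') {b S : Finset (Fin d)}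
    (hS : a ∉ S) (hS' : a' ∉ S)
    (hb : ColLE (insert a' S) b ↔ ColLE (insert a S) b) :
    act (Equiv.swap a a') (colTerm h n c b (insert a S) + colTerm h n c b (insert a' S)) =
      colTerm h n c b (insert a S) + colTerm h n c b (insert a' S) := by
  rw [colTerm_insert_left h n c hS, colTerm_insert_left h n c hS', hb,
    prod_colFactor_insert ha hS hS']
  split_ifs
  · have h1 := H.rel S hS hS'
    have h0 := cnt_eq_cnt_succ S a'
    rw [if_neg hS', ha] at h0
    have h2 : ((d : ℤ) - (a' : ℕ) + ((c + 1 : ℕ) : ℤ) - (cnt S (a' + 1) : ℤ)) =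
        (d : ℤ) - (a : ℕ) + c - (cnt S (a + 1) : ℤ) := by
      rw [ha]
      push_cast
      omega
    rw [h2] at h1
    simp only [map_add, map_mul, map_sub, act_x, act_yI, Equiv.swap_apply_left,
      Equiv.swap_apply_right, act_swap_prod_colFactor hS hS',
      H.inv (insert a' S) (Or.inl (by simp))]
    linear_combination (-(∏ i ∈ S, colFactor c (insert a S) i)) * h1
  · simp

theorem act_colGroup {h : ℕ → ℕ} {n c : ℕ} {a a' : Fin d}
    (ha : (a' : ℕ) = a + 1) (H : SwapInv h n (c + 1) a a') {b S : Finset (Fin d)}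
    (hS : a ∉ S) (hS' : a' ∉ S)
    (hb : ColLE (insert a' S) b ↔ ColLE (insert a S) b) :
    act (Equiv.swap a a') (colGroup h n c a a' b S) = colGroup h n c a a' b S := by
  have h1 := act_colTerm_of_notMem H (b := b) hS hS'
  have h2 := act_colTerm_insert_insert ha H (b := b) hS hS'
  have h3 := act_colTerm_pair ha H hS hS' hb
  rw [map_add] at h3
  simp only [colGroup, map_add]
  linear_combination h1 + h2 + h3

theorem colLE_insert_right_iff {a a' : Fin d} (ha : (a' : ℕ) = a + 1) {S b : Finset (Fin d)}
    (hb : a ∉ b) (hb' : a' ∉ b) (hS : a ∈ S ∨ a' ∉ S) :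
    ColLE S (insert a' b) ↔ ColLE S (insert a b) := by
  have h1 := cnt_eq_cnt_succ S a
  have h2 := cnt_eq_cnt_succ S a'
  have h3 := cnt_eq_cnt_succ b a
  have h4 := cnt_eq_cnt_succ b a'
  rw [if_neg hb] at h3
  rw [if_neg hb'] at h4
  rw [ha] at h2 h4
  constructor
  · intro H v
    rw [cnt_insert hb]
    by_cases hv : v = a + 1
    · have H0 := H a
      have H2 := H (a + 1 + 1)
      rw [cnt_insert hb'] at H0 H2
      subst hv
      split_ifs at * <;> first | omega | tauto
    · have := H v
      rw [cnt_insert hb'] at this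
      split_ifs at * <;> omega
  · intro H v
    have := H v
    rw [cnt_insert hb] at this
    rw [cnt_insert hb']
    split_ifs at * <;> omega

theorem colLE_insert_insert_iff {a a' : Fin d} (ha : (a' : ℕ) = a + 1) {S b : Finset (Fin d)}
    (hb : a ∉ b) (hb' : a' ∉ b) (hS' : a' ∉ S)
    (hne : cnt S (a' + 1) ≠ cnt b (a' + 1)) :
    ColLE (insert a' S) (insert a' b) ↔ ColLE (insert a' S) (insert a b) := by
  have h2 := cnt_eq_cnt_succ S a'
  have h4 := cnt_eq_cnt_succ b a'
  rw [if_neg hS'] at h2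
  rw [if_neg hb'] at h4
  rw [ha] at h2 h4 hne
  constructor
  · intro H v
    have := H v
    rw [cnt_insert hS', cnt_insert hb'] at this
    rw [cnt_insert hS', cnt_insert hb]
    by_cases hv : v = a + 1
    · subst hv
      split_ifs at * <;> omega
    · split_ifs at * <;> omega
  · intro H v
    have := H v
    rw [cnt_insert hS', cnt_insert hb] at this
    rw [cnt_insert hS', cnt_insert hb']
    split_ifs at * <;> omega

theorem not_colLE_insert_insert {a a' : Fin d} (ha : (a' : ℕ) = a + 1) {S b : Finset (Fin d)}
    (hb : a ∉ b) (hb' : a' ∉ b) (hS' : a' ∉ S)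
    (he : cnt S (a' + 1) = cnt b (a' + 1)) :
    ¬ ColLE (insert a' S) (insert a b) := by
  have h2 := cnt_eq_cnt_succ S a'
  have h4 := cnt_eq_cnt_succ b a'
  rw [if_neg hS'] at h2
  rw [if_neg hb'] at h4
  intro H
  have := H a'
  rw [cnt_insert hS', cnt_insert hb] at this
  split_ifs at * <;> omega

theorem colGroup_rel {h : ℕ → ℕ} {n c : ℕ} {a a' : Fin d}
    (ha : (a' : ℕ) = a + 1) (H : SwapInv h n (c + 1) a a') {b S : Finset (Fin d)}
    (hb : a ∉ b) (hb' : a' ∉ b) (hS : a ∉ S) (hS' : a' ∉ S) :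
    (X (Sum.inl a') - X (Sum.inl a)) * colGroup h n c a a' (insert a' b) S =
      (X (Sum.inl a') - yI d ((d : ℤ) - (a' : ℕ) + c - cnt b (a' + 1))) *
          act (Equiv.swap a a') (colGroup h n c a a' (insert a b) S) -
        (X (Sum.inl a) - yI d ((d : ℤ) - (a' : ℕ) + c - cnt b (a' + 1))) *
          colGroup h n c a a' (insert a b) S := by
  have hne : a ≠ a' := fun h => by simp [h] at ha
  have t0 : colTerm h n c (insert a' b) S = colTerm h n c (insert a b) S := by
    simp only [colTerm, colLE_insert_right_iff ha hb hb' (Or.inr hS')]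
  have t1 : colTerm h n c (insert a' b) (insert a S) =
      colTerm h n c (insert a b) (insert a S) := by
    simp only [colTerm, colLE_insert_right_iff ha hb hb' (S := insert a S) (by simp)]
  have t2 : colTerm h n c (insert a' b) (insert a (insert a' S)) =
      colTerm h n c (insert a b) (insert a (insert a' S)) := by
    simp only [colTerm,
      colLE_insert_right_iff ha hb hb' (S := insert a (insert a' S)) (by simp)]
  have hpair := colLE_insert_iff ha hS hS' (b := insert a' b) (by simp)
  have hright := colLE_insert_right_iff ha hb hb' (S := insert a S) (by simp)
  by_cases he : cnt S (a' + 1) = cnt b (a' + 1)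
  · have h1 := act_colTerm_of_notMem H (b := insert a b) hS hS'
    have h2 := act_colTerm_insert_insert ha H (b := insert a b) hS hS'
    have t3 : colTerm h n c (insert a b) (insert a' S) = 0 := by
      rw [colTerm, if_neg fun h => not_colLE_insert_insert ha hb hb' hS' he h.2]
    simp only [colGroup, t0, t1, t2, t3, map_add, map_zero, h1, h2]
    rw [colTerm_insert_left h n c hS, colTerm_insert_left h n c hS', hpair, hright,
      prod_colFactor_insert ha hS hS', ← he]
    split_ifs
    · have h3 := H.rel S hS hS'
      have h0 := cnt_eq_cnt_succ S a'
      rw [if_neg hS', ha] at h0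
      have h4 : ((d : ℤ) - (a' : ℕ) + ((c + 1 : ℕ) : ℤ) - (cnt S (a' + 1) : ℤ)) =
          (d : ℤ) - (a : ℕ) + c - (cnt S (a + 1) : ℤ) := by
        rw [ha]
        push_cast
        omega
      rw [h4] at h3
      simp only [map_mul, map_sub, act_x, act_yI, Equiv.swap_apply_left,
        act_swap_prod_colFactor hS hS']
      linear_combination
        (X (Sum.inl a') - yI d ((d : ℤ) - (a' : ℕ) + c - cnt S (a' + 1))) *
          (∏ i ∈ S, colFactor c (insert a S) i) * h3
    · simp only [map_zero]
      ring
  · have t3 : colTerm h n c (insert a' b) (insert a' S) =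
        colTerm h n c (insert a b) (insert a' S) := by
      simp only [colTerm, colLE_insert_insert_iff ha hb hb' hS' he]
    have hg : colGroup h n c a a' (insert a' b) S = colGroup h n c a a' (insert a b) S := by
      simp only [colGroup, t0, t1, t2, t3]
    rw [← hg, act_colGroup ha H hS hS' hpair]
    ring

theorem swapInv (h : ℕ → ℕ) {a a' : Fin d} (ha : (a' : ℕ) = a + 1) (n c : ℕ) :
    SwapInv h n c a a' := by
  have hne : a ≠ a' := fun h => by simp [h] at ha
  have hmem : ∀ S ∈ (Finset.univ \ {a, a'}).powerset, a ∉ S ∧ a' ∉ S := by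
    intro S hS
    rw [Finset.mem_powerset] at hS
    exact ⟨fun h => by simpa using hS h, fun h => by simpa using hS h⟩
  induction n generalizing c with
  | zero => exact ⟨fun b _ => by simp [colSum], fun b _ _ => by simp [colSum]⟩
  | succ n ih =>
    refine ⟨fun b hb => ?_, fun b hb hb' => ?_⟩
    · rw [colSum_succ_eq_sum_colGroup h n c hne, map_sum]
      refine Finset.sum_congr rfl fun S hS => ?_
      obtain ⟨h1, h2⟩ := hmem S hS
      exact act_colGroup ha (ih (c + 1)) h1 h2 (colLE_insert_iff ha h1 h2 hb)
    · rw [colSum_succ_eq_sum_colGroup h n c hne, colSum_succ_eq_sum_colGroup h n c hne,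
        map_sum, Finset.mul_sum, Finset.mul_sum, Finset.mul_sum, ← Finset.sum_sub_distrib]
      refine Finset.sum_congr rfl fun S hS => ?_
      obtain ⟨h1, h2⟩ := hmem S hS
      exact colGroup_rel ha (ih (c + 1)) hb hb' h1 h2

end Columns

/-! ### Alternants -/

section Alternants

variable {d : ℕ}

/-- The antisymmetrization of `p` in the variables `x`. -/
def alt (p : P d) : P d := ∑ σ : Equiv.Perm (Fin d), Equiv.Perm.sign σ • act σ p

theorem alt_sum {ι : Type*} (s : Finset ι) (f : ι → P d) :
    alt (∑ i ∈ s, f i) = ∑ i ∈ s, alt (f i) := by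
  simp only [alt, map_sum, Finset.smul_sum]
  exact Finset.sum_comm

theorem alt_zero : alt (0 : P d) = 0 := by simp [alt]

theorem alt_mul {q : P d} (hq : ∀ σ, act σ q = q) (p : P d) : alt (q * p) = q * alt p := by
  simp only [alt, map_mul, hq, Finset.mul_sum, mul_smul_comm]

theorem alt_eq_zero {p : P d} {a a' : Fin d} (ha : a ≠ a')
    (hp : act (Equiv.swap a a') p = p) : alt p = 0 := by
  have h : alt p = -alt p := by
    conv_lhs => rw [alt, ← Equiv.sum_comp (Equiv.mulRight (Equiv.swap a a'))]
    rw [alt, ← Finset.sum_neg_distrib]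
    refine Finset.sum_congr rfl fun σ _ => ?_
    rw [Equiv.coe_mulRight, ← act_act, hp, Equiv.Perm.sign_mul, Equiv.Perm.sign_swap ha]
    simp
  exact self_eq_neg.mp h

theorem act_ffPow (σ : Equiv.Perm (Fin d)) (j : Fin d) (k : ℕ) :
    act σ (ffPow d j k) = ffPow d (σ j) k := by
  simp [ffPow, map_prod]

theorem act_xyPow (σ : Equiv.Perm (Fin d)) (ξ : Fin d → ℕ) :
    act σ (xyPow d ξ) = ∏ j, ffPow d (σ j) (ξ j) := by
  simp [xyPow, map_prod, act_ffPow]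

theorem aDet_eq_alt (ξ : Fin d → ℕ) : aDet d ξ = alt (xyPow d ξ) := by
  rw [aDet, ← Matrix.det_transpose, Matrix.det_apply, alt]
  simp [act_xyPow]

theorem act_swap_xyPow {a a' : Fin d} {ξ : Fin d → ℕ} (h : ξ a = ξ a') :
    act (Equiv.swap a a') (xyPow d ξ) = xyPow d ξ := by
  rw [act_xyPow, xyPow, ← Equiv.prod_comp (Equiv.swap a a') fun j => ffPow d j (ξ j)]
  refine Finset.prod_congr rfl fun j _ => ?_
  congr 1
  rw [Equiv.swap_apply_def]
  split_ifs with h1 h2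
  · rw [h1, h]
  · rw [h2, h]
  · rfl

theorem act_eq_self {p : P d}
    (hp : ∀ a a' : Fin d, (a' : ℕ) = a + 1 → act (Equiv.swap a a') p = p)
    (σ : Equiv.Perm (Fin d)) : act σ p = p := by
  cases d with
  | zero =>
    have : σ = 1 := Subsingleton.elim _ _
    subst this
    simp [act]
  | succ n =>
    have hσ : σ ∈ Submonoid.closure
        (Set.range fun i : Fin n => Equiv.swap i.castSucc i.succ) := by
      rw [Equiv.Perm.mclosure_swap_castSucc_succ]
      trivial
    induction hσ using Submonoid.closure_induction with
    | mem x hx =>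
      obtain ⟨i, rfl⟩ := hx
      exact hp _ _ (by simp)
    | one => simp [act]
    | mul x y _ _ hx hy => rw [← act_act, hy, hx]

theorem act_colSum_univ (h : ℕ → ℕ) (n c : ℕ) (σ : Equiv.Perm (Fin d)) :
    act σ (colSum h n c Finset.univ) = colSum h n c Finset.univ :=
  act_eq_self (fun _ _ ha => (swapInv h ha n c).inv _ (by simp)) σ

theorem aDet_rho_ne_zero : aDet d (rho d) ≠ 0 := by
  let p : Fin d → Polynomial (P d) := fun i =>
    ∏ k ∈ Finset.range i, (Polynomial.X - Polynomial.C (yI d ((k : ℤ) + 1)))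
  have hdeg : ∀ i, (p i).natDegree = i := by
    intro i
    rw [Polynomial.natDegree_prod_of_monic _ _ fun k _ => Polynomial.monic_X_sub_C _]
    simp
  have hmonic : ∀ i, (p i).Monic := fun i =>
    Polynomial.monic_prod_of_monic _ _ fun k _ => Polynomial.monic_X_sub_C _
  have h1 := Matrix.det_eval_matrixOfPolynomials_eq_det_vandermonde
    (fun i : Fin d => (X (Sum.inl i) : P d)) p hdeg hmonic
  have h2 : Matrix.det (Matrix.of fun i j : Fin d => (p j).eval (X (Sum.inl i) : P d)) ≠ 0 := by
    rw [← h1, Matrix.det_vandermonde_ne_zero_iff]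
    intro i j hij
    simpa using X_injective hij
  have h3 : (Matrix.of fun i j : Fin d => ffPow d j (rho d i)) =
      ((Matrix.of fun i j : Fin d => (p j).eval (X (Sum.inl i) : P d)).transpose).submatrix
        Fin.revPerm id := by
    ext1 i j
    simp only [Matrix.of_apply, Matrix.submatrix_apply, Matrix.transpose_apply, id,
      Fin.revPerm_apply, p, Polynomial.eval_prod, ffPow, rho, Fin.val_rev]
    simp [Nat.sub_sub, add_comm]
  rw [aDet, h3, Matrix.det_permute, Matrix.det_transpose]
  refine mul_ne_zero ?_ h2
  rcases Int.units_eq_one_or (Equiv.Perm.sign (Fin.revPerm (n := d))) with h | h <;> simp [h]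

/-- `ξ + 1_T`. -/
def addInd (ξ : Fin d → ℕ) (T : Finset (Fin d)) : Fin d → ℕ :=
  fun i => ξ i + if i ∈ T then 1 else 0

/-- `ξ_1 > ξ_2 > … > ξ_d`. -/
def Strict (ξ : Fin d → ℕ) : Prop := ∀ i j : Fin d, (j : ℕ) = i + 1 → ξ j < ξ i

/-- The product over the barred entries of the `c`-th column, where `S` is the set of all
entries and `T` that of the unbarred ones. -/
def colCoef (c : ℕ) (ξ : Fin d → ℕ) (S T : Finset (Fin d)) : P d :=
  ∏ i ∈ S \ T, (yI d ((ξ i : ℤ) + 1) - yI d ((d : ℤ) - (i : ℕ) + c - cnt S (i + 1)))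

theorem act_colCoef (c : ℕ) (ξ : Fin d → ℕ) (S T : Finset (Fin d)) (σ : Equiv.Perm (Fin d)) :
    act σ (colCoef c ξ S T) = colCoef c ξ S T := by
  simp [colCoef, map_prod]

theorem xyPow_addInd (ξ : Fin d → ℕ) (T : Finset (Fin d)) :
    xyPow d (addInd ξ T) =
      xyPow d ξ * ∏ i ∈ T, (X (Sum.inl i) - yI d ((ξ i : ℤ) + 1)) := by
  have h : ∏ i ∈ T, ((X (Sum.inl i) : P d) - yI d ((ξ i : ℤ) + 1)) =
      ∏ i, if i ∈ T then ((X (Sum.inl i) : P d) - yI d ((ξ i : ℤ) + 1)) else 1 := by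
    simp
  rw [h, xyPow, xyPow, ← Finset.prod_mul_distrib]
  refine Finset.prod_congr rfl fun i _ => ?_
  unfold addInd ffPow
  split_ifs
  · rw [Finset.prod_range_succ]
  · simp

theorem xyPow_mul_colWt (c : ℕ) (ξ : Fin d → ℕ) (S : Finset (Fin d)) :
    xyPow d ξ * colWt c S =
      ∑ T ∈ S.powerset, colCoef c ξ S T * xyPow d (addInd ξ T) := by
  have h : colWt c S = ∏ i ∈ S, ((X (Sum.inl i) - yI d ((ξ i : ℤ) + 1)) +
      (yI d ((ξ i : ℤ) + 1) - yI d ((d : ℤ) - (i : ℕ) + c - cnt S (i + 1)))) := by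
    refine Finset.prod_congr rfl fun i _ => ?_
    rw [colFactor]
    ring
  rw [h, Finset.prod_add, Finset.mul_sum]
  refine Finset.sum_congr rfl fun T _ => ?_
  rw [xyPow_addInd, colCoef]
  ring

/-- The column with entry set `p.1` and set of unbarred entries `p.2` may stand at position
`c`, to the left of a column with entry set `b`. -/
def BarredColOK (h : ℕ → ℕ) (c : ℕ) (b : Finset (Fin d))
    (p : Finset (Fin d) × Finset (Fin d)) : Prop :=
  p.1.card = h c ∧ ColLE p.1 b ∧ p.2 ⊆ p.1

/-- The sum over all barred fillings of the columns `c, …, c + n - 1` all of whose column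
prefixes keep the vector `ξ` strictly decreasing. -/
def yamSum (h : ℕ → ℕ) : ℕ → ℕ → Finset (Fin d) → (Fin d → ℕ) → P d
  | 0, _, _, ξ => aDet d ξ
  | n + 1, c, b, ξ => ∑ p : Finset (Fin d) × Finset (Fin d),
      if BarredColOK h c b p ∧ Strict (addInd ξ p.2) then
        colCoef c ξ p.1 p.2 * yamSum h n (c + 1) p.1 (addInd ξ p.2) else 0

theorem xyPow_mul_colSum_succ (h : ℕ → ℕ) (n c : ℕ) (b : Finset (Fin d)) (ξ : Fin d → ℕ) :
    xyPow d ξ * colSum h (n + 1) c b =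
      ∑ p : Finset (Fin d) × Finset (Fin d),
        if BarredColOK h c b p then
          colCoef c ξ p.1 p.2 * (xyPow d (addInd ξ p.2) * colSum h n (c + 1) p.1) else 0 := by
  rw [colSum, Finset.mul_sum, Fintype.sum_prod_type]
  refine Finset.sum_congr rfl fun S _ => ?_
  by_cases hS : S.card = h c ∧ ColLE S b
  · rw [if_pos hS, ← mul_assoc, xyPow_mul_colWt, Finset.sum_mul]
    simp only [BarredColOK, hS, true_and]
    rw [← Finset.sum_filter]
    refine Finset.sum_congr ?_ fun T _ => by ring
    ext T
    simp
  · rw [if_neg hS, mul_zero]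
    refine (Finset.sum_eq_zero fun T _ => if_neg fun h => hS ⟨h.1, h.2.1⟩).symm

theorem alt_xyPow_mul_colSum (h : ℕ → ℕ) (n c : ℕ) (b : Finset (Fin d)) {ξ : Fin d → ℕ}
    (hξ : Strict ξ) : alt (xyPow d ξ * colSum h n c b) = yamSum h n c b ξ := by
  induction n generalizing c b ξ with
  | zero => rw [colSum, yamSum, mul_one, aDet_eq_alt]
  | succ n ih =>
    rw [xyPow_mul_colSum_succ, alt_sum, yamSum]
    refine Finset.sum_congr rfl fun p _ => ?_
    by_cases hp : BarredColOK h c b p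
    · rw [if_pos hp, alt_mul (act_colCoef _ _ _ _)]
      by_cases hs : Strict (addInd ξ p.2)
      · rw [if_pos ⟨hp, hs⟩, ih _ _ hs]
      · rw [if_neg fun h => hs h.2]
        unfold Strict at hs
        push Not at hs
        obtain ⟨i, j, hij, hle⟩ := hs
        have h1 := hξ i j hij
        have h2 : j ∈ p.2 ∧ addInd ξ p.2 i = addInd ξ p.2 j := by
          unfold addInd at *
          split_ifs at * <;> first | omega | (refine ⟨by assumption, by omega⟩)
        have hne : i ≠ j := fun h => by simp [h] at hij
        rw [alt_eq_zero hne, mul_zero]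
        rw [map_mul, act_swap_xyPow h2.2, (swapInv h hij n (c + 1)).inv _ (Or.inl (hp.2.2 h2.1))]
    · rw [if_neg hp, if_neg fun h => hp h.1, alt_zero]

theorem aDet_mul_colSum_univ (h : ℕ → ℕ) (n : ℕ) {ξ : Fin d → ℕ} (hξ : Strict ξ) :
    aDet d ξ * colSum h n 0 Finset.univ = yamSum h n 0 Finset.univ ξ := by
  rw [← alt_xyPow_mul_colSum h n 0 _ hξ, mul_comm (xyPow d ξ),
    alt_mul (act_colSum_univ h n 0), aDet_eq_alt, mul_comm]

/-! ### The bialternant formula -/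

theorem card_filter_lt {n : ℕ} (hn : n ≤ d) :
    (Finset.univ.filter fun i : Fin d => (i : ℕ) < n).card = n := by
  rw [Fin.card_filter_val_lt, min_eq_right hn]

theorem eq_filter_lt_of_succ_mem {T : Finset (Fin d)}
    (hT : ∀ i j : Fin d, (j : ℕ) = i + 1 → j ∈ T → i ∈ T) :
    T = Finset.univ.filter fun i : Fin d => (i : ℕ) < T.card := by
  have hdown : ∀ (k : ℕ) (i j : Fin d), (j : ℕ) = i + k → j ∈ T → i ∈ T := by
    intro k
    induction k with
    | zero =>
      intro i j hij hj
      have : i = j := Fin.ext (by omega)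
      rwa [this]
    | succ k ih =>
      intro i j hij hj
      exact hT i ⟨i + 1, by omega⟩ rfl (ih _ j (by simp; omega) hj)
  have hsub : T ⊆ Finset.univ.filter fun i : Fin d => (i : ℕ) < T.card := by
    intro i hi
    simp only [Finset.mem_filter, Finset.mem_univ, true_and]
    have h1 : Finset.Iic i ⊆ T := fun j hj => by
      rw [Finset.mem_Iic, Fin.le_def] at hj
      exact hdown (i - j) j i (by omega) hi
    have h2 := Finset.card_le_card h1
    rw [Fin.card_Iic] at h2
    omega
  refine Finset.eq_of_subset_of_card_le hsub ?_
  rw [card_filter_lt (by simpa using Finset.card_le_univ T)]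

theorem eq_filter_lt_of_colCoef_ne_zero {h : ℕ → ℕ} {c t : ℕ} {ξ : Fin d → ℕ}
    (hξ : ∀ i : Fin d, (i : ℕ) < t → ξ i = rho d i + c)
    {p : Finset (Fin d) × Finset (Fin d)}
    (hp : BarredColOK h c (Finset.univ.filter fun i : Fin d => (i : ℕ) < t) p)
    (hs : Strict (addInd ξ p.2)) (h0 : colCoef c ξ p.1 p.2 ≠ 0) :
    p = (Finset.univ.filter fun i : Fin d => (i : ℕ) < h c,
      Finset.univ.filter fun i : Fin d => (i : ℕ) < h c) := by
  obtain ⟨S, T⟩ := p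
  obtain ⟨hcard, hle, hsub⟩ := hp
  simp only at hcard hle hsub hs h0
  have hSt : ∀ i ∈ S, (i : ℕ) < t := by
    intro i hi
    have h1 : 0 < cnt S i := Finset.card_pos.mpr ⟨i, by simp [hi]⟩
    obtain ⟨j, hj⟩ := Finset.card_pos.mp (h1.trans_le (hle i))
    simp only [Finset.mem_filter, Finset.mem_univ, true_and] at hj
    omega
  have hT : T = Finset.univ.filter fun i : Fin d => (i : ℕ) < T.card := by
    refine eq_filter_lt_of_succ_mem fun i j hij hj => ?_
    by_contra hi
    have h1 := hs i j hij
    have h2 := hSt j (hsub hj)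
    rw [addInd, addInd, if_pos hj, if_neg hi, hξ j h2, hξ i (by omega), rho, rho] at h1
    omega
  have hST : S = T := by
    by_contra hne
    have hnotsub : ¬ S ⊆ T := fun h => hne (Finset.Subset.antisymm h hsub)
    obtain ⟨i, hiS, hiT⟩ := Finset.not_subset.mp hnotsub
    have hSne : S.Nonempty := ⟨i, hiS⟩
    have hmax := S.max'_mem hSne
    apply h0
    refine Finset.prod_eq_zero (i := S.max' hSne) ?_ ?_
    · rw [Finset.mem_sdiff]
      refine ⟨hmax, fun hmT => hiT ?_⟩
      rw [hT, Finset.mem_filter] at hmT ⊢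
      have := S.le_max' i hiS
      rw [Fin.le_def] at this
      exact ⟨Finset.mem_univ _, by omega⟩
    · have hc : cnt S (S.max' hSne + 1) = 0 := by
        rw [cnt, Finset.card_eq_zero, Finset.filter_eq_empty_iff]
        intro j hj hlt
        have := S.le_max' j hj
        rw [Fin.le_def] at this
        omega
      rw [hc, hξ _ (hSt _ hmax), rho, sub_eq_zero]
      congr 1
      have := (S.max' hSne).isLt
      push_cast
      omega
  subst hST
  rw [hcard] at hT
  rw [← hT]

theorem yamSum_of_rho {h : ℕ → ℕ} (hh : Antitone h) (n c : ℕ) {t : ℕ} {ξ : Fin d → ℕ}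
    (hξ : ∀ i : Fin d, (i : ℕ) < t → ξ i = rho d i + c) (hs : Strict ξ) (ht : t ≤ d)
    (hct : h c ≤ t) :
    yamSum h n c (Finset.univ.filter fun i : Fin d => (i : ℕ) < t) ξ =
      aDet d fun i => ξ i + ((Finset.range n).filter fun j => (i : ℕ) < h (c + j)).card := by
  induction n generalizing c t ξ with
  | zero => simp [yamSum]
  | succ n ih =>
    set S : Finset (Fin d) := Finset.univ.filter fun i : Fin d => (i : ℕ) < h c with hS
    have hs' : Strict (addInd ξ S) := by
      intro i j hij
      have := hs i j hij
      simp only [addInd, hS, Finset.mem_filter, Finset.mem_univ, true_and]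
      split_ifs <;> omega
    have hok : BarredColOK h c (Finset.univ.filter fun i : Fin d => (i : ℕ) < t) (S, S) := by
      refine ⟨card_filter_lt (hct.trans ht), fun v => Finset.card_le_card ?_, le_rfl⟩
      intro i
      simp only [hS, Finset.mem_filter, Finset.mem_univ, true_and]
      omega
    rw [yamSum, Finset.sum_eq_single (S, S)]
    · rw [if_pos ⟨hok, hs'⟩]
      simp only
      rw [hS, ih (c + 1) (t := h c) (ξ := addInd ξ S) _ hs' (hct.trans ht) (hh (Nat.le_succ c))]
      · rw [colCoef, Finset.sdiff_self, Finset.prod_empty, one_mul]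
        congr 1
        ext i
        simp only [Finset.card_filter]
        rw [Finset.sum_range_succ', addInd, hS]
        simp only [Finset.mem_filter, Finset.mem_univ, true_and, add_zero]
        rw [add_assoc, add_comm (ite _ _ _)]
        simp only [add_assoc, add_comm 1]
      · intro i hi
        rw [addInd, hS, if_pos (by simpa using hi), hξ i (hi.trans_le hct), add_assoc]
    · intro p _ hp
      split_ifs with hpok
      · by_cases h0 : colCoef c ξ p.1 p.2 = 0
        · rw [h0, zero_mul]
        · exact absurd (eq_filter_lt_of_colCoef_ne_zero hξ hpok.1 hpok.2 h0) hp
      · rfl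
    · simp

theorem strict_rho : Strict (rho d) := fun i j hij => by
  unfold rho
  omega

theorem aDet_rho_mul_colSum {h : ℕ → ℕ} (hh : Antitone h) (h0 : h 0 ≤ d) (n : ℕ) :
    aDet d (rho d) * colSum h n 0 Finset.univ =
      aDet d fun i => rho d i + ((Finset.range n).filter fun j => (i : ℕ) < h j).card := by
  have h1 := yamSum_of_rho hh n 0 (t := d) (ξ := rho d) (fun i _ => by simp) strict_rho le_rfl h0
  simp only [Fin.is_lt, Finset.filter_true, zero_add] at h1
  rw [aDet_mul_colSum_univ h n strict_rho, h1]

end Alternants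

/-! ### Columns of tableaux -/

section Tableaux

variable {d : ℕ}

/-- `v 0 > v 1 > … > v (n - 1)` are values in `{1, …, d}`. -/
structure IsCol (d n : ℕ) (v : ℕ → ℕ) : Prop where
  mem : ∀ r < n, 1 ≤ v r ∧ v r ≤ d
  anti : ∀ r s, r < s → s < n → v s < v r

/-- The set of entries of a column. -/
def valSet (d n : ℕ) (v : ℕ → ℕ) : Finset (Fin d) :=
  Finset.univ.filter fun i : Fin d => ∃ r < n, v r = i + 1

theorem IsCol.prod_eq {n : ℕ} {v : ℕ → ℕ} (hv : IsCol d n v) {M : Type*} [CommMonoid M]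
    (ψ : ℕ → M) : ∏ r ∈ Finset.range n, ψ (v r) = ∏ i ∈ valSet d n v, ψ (i + 1) := by
  refine Finset.prod_bij (fun r hr => ⟨v r - 1, ?_⟩) ?_ ?_ ?_ ?_
  · have := hv.mem r (Finset.mem_range.mp hr)
    omega
  · intro r hr
    have h := hv.mem r (Finset.mem_range.mp hr)
    simp only [valSet, Finset.mem_filter, Finset.mem_univ, true_and]
    exact ⟨r, Finset.mem_range.mp hr, by omega⟩
  · intro r hr s hs h
    rw [Finset.mem_range] at hr hs
    have h1 := hv.mem r hr
    have h2 := hv.mem s hs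
    simp only [Fin.mk.injEq] at h
    rcases lt_trichotomy r s with h3 | h3 | h3
    · have := hv.anti r s h3 hs
      omega
    · exact h3
    · have := hv.anti s r h3 hr
      omega
  · intro i hi
    simp only [valSet, Finset.mem_filter, Finset.mem_univ, true_and] at hi
    obtain ⟨r, hr, h⟩ := hi
    exact ⟨r, Finset.mem_range.mpr hr, Fin.ext (by simp [h])⟩
  · intro r hr
    have h := hv.mem r (Finset.mem_range.mp hr)
    congr 1
    simp only
    omega

theorem IsCol.cnt_valSet {n : ℕ} {v : ℕ → ℕ} (hv : IsCol d n v) (k : ℕ) :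
    cnt (valSet d n v) k = ((Finset.range n).filter fun r => k < v r).card := by
  rw [cnt, Finset.card_filter, Finset.card_filter]
  refine Eq.trans ?_ (Multiplicative.ofAdd.injective
    (hv.prod_eq fun w => Multiplicative.ofAdd (if k < w then 1 else 0))).symm
  refine Finset.sum_congr rfl fun i _ => ?_
  simp only [Nat.lt_succ_iff]
  rfl

theorem IsCol.cnt_val {n : ℕ} {v : ℕ → ℕ} (hv : IsCol d n v) {r : ℕ} (hr : r < n) :
    cnt (valSet d n v) (v r) = r := by
  rw [hv.cnt_valSet]
  have : (Finset.range n).filter (fun s => v r < v s) = Finset.range r := by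
    ext s
    simp only [Finset.mem_filter, Finset.mem_range]
    constructor
    · rintro ⟨h1, h2⟩
      by_contra h3
      rcases Nat.lt_or_ge r s with h4 | h4
      · have := hv.anti r s h4 h1
        omega
      · have : r = s := by omega
        subst this
        omega
    · intro h
      exact ⟨h.trans hr, hv.anti s r h hr⟩
  rw [this, Finset.card_range]

theorem IsCol.card_valSet {n : ℕ} {v : ℕ → ℕ} (hv : IsCol d n v) :
    (valSet d n v).card = n := by
  have h := hv.cnt_valSet 0
  rw [Finset.filter_true_of_mem fun r hr =>
    show 0 < v r from (hv.mem r (Finset.mem_range.mp hr)).1, Finset.card_range] at h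
  rwa [cnt, Finset.filter_true_of_mem fun _ _ => Nat.zero_le _] at h

theorem IsCol.prod_eq_rank {n : ℕ} {v : ℕ → ℕ} (hv : IsCol d n v) {M : Type*} [CommMonoid M]
    (φ : ℕ → ℕ → M) :
    ∏ r ∈ Finset.range n, φ r (v r) =
      ∏ i ∈ valSet d n v, φ (cnt (valSet d n v) (i + 1)) (i + 1) := by
  rw [← hv.prod_eq fun w => φ (cnt (valSet d n v) w) w]
  refine Finset.prod_congr rfl fun r hr => ?_
  rw [hv.cnt_val (Finset.mem_range.mp hr)]

theorem IsCol.sum_eq_rank {n : ℕ} {v : ℕ → ℕ} (hv : IsCol d n v) {M : Type*} [AddCommMonoid M]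
    (φ : ℕ → ℕ → M) :
    ∑ r ∈ Finset.range n, φ r (v r) =
      ∑ i ∈ valSet d n v, φ (cnt (valSet d n v) (i + 1)) (i + 1) :=
  Multiplicative.ofAdd.injective
    (hv.prod_eq_rank fun r w => Multiplicative.ofAdd (φ r w))

theorem IsCol.colLE_iff {n m : ℕ} {v w : ℕ → ℕ} (hv : IsCol d n v) (hw : IsCol d m w)
    (hnm : n ≤ m) : ColLE (valSet d n v) (valSet d m w) ↔ ∀ r < n, v r ≤ w r := by
  constructor
  · intro H r hr
    by_contra! hlt
    have h1 := H (v r - 1)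
    rw [hv.cnt_valSet, hw.cnt_valSet] at h1
    have hpos := (hv.mem r hr).1
    have h2 : r + 1 ≤ ((Finset.range n).filter fun s => v r - 1 < v s).card := by
      rw [← Finset.card_range (r + 1)]
      refine Finset.card_le_card fun s hs => ?_
      rw [Finset.mem_range] at hs
      rw [Finset.mem_filter, Finset.mem_range]
      refine ⟨by omega, ?_⟩
      rcases Nat.lt_or_ge s r with h | h
      · have := hv.anti s r h hr
        omega
      · have : s = r := by omega
        subst this
        omega
    have h3 : ((Finset.range m).filter fun s => v r - 1 < w s).card ≤ r := by
      conv_rhs => rw [← Finset.card_range r]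
      refine Finset.card_le_card fun s hs => ?_
      rw [Finset.mem_filter, Finset.mem_range] at hs
      rw [Finset.mem_range]
      by_contra! h
      rcases Nat.lt_or_ge r s with h4 | h4
      · have := hw.anti r s h4 hs.1
        omega
      · have : s = r := by omega
        subst this
        omega
    omega
  · intro H k
    rw [hv.cnt_valSet, hw.cnt_valSet]
    refine Finset.card_le_card fun s hs => ?_
    rw [Finset.mem_filter, Finset.mem_range] at hs ⊢
    exact ⟨by omega, hs.2.trans_le (H s hs.1)⟩

theorem IsCol.eq_of_valSet_eq {n : ℕ} {v w : ℕ → ℕ} (hv : IsCol d n v) (hw : IsCol d n w)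
    (h : valSet d n v = valSet d n w) {r : ℕ} (hr : r < n) : v r = w r := by
  refine le_antisymm ((hv.colLE_iff hw le_rfl).mp ?_ r hr) ((hw.colLE_iff hv le_rfl).mp ?_ r hr)
  · rw [h]
    exact fun _ => le_rfl
  · rw [h]
    exact fun _ => le_rfl

/-- The entries of the column with entry set `S`, from bottom to top. -/
def sortedCol (S : Finset (Fin d)) (r : ℕ) : ℕ :=
  if h : r < S.card then (S.orderEmbOfFin rfl (Fin.rev ⟨r, h⟩) : ℕ) + 1 else 0

theorem isCol_sortedCol (S : Finset (Fin d)) : IsCol d S.card (sortedCol S) where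
  mem r hr := by
    rw [sortedCol, dif_pos hr]
    have := (S.orderEmbOfFin rfl (Fin.rev ⟨r, hr⟩)).isLt
    omega
  anti r s hrs hs := by
    rw [sortedCol, sortedCol, dif_pos hs, dif_pos (hrs.trans hs)]
    have : S.orderEmbOfFin rfl (Fin.rev ⟨s, hs⟩) <
        S.orderEmbOfFin rfl (Fin.rev ⟨r, hrs.trans hs⟩) := by
      rw [OrderEmbedding.lt_iff_lt, Fin.rev_lt_rev]
      exact hrs
    rw [Fin.lt_def] at this
    omega

theorem valSet_sortedCol (S : Finset (Fin d)) : valSet d S.card (sortedCol S) = S := by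
  ext i
  simp only [valSet, Finset.mem_filter, Finset.mem_univ, true_and]
  constructor
  · rintro ⟨r, hr, h⟩
    rw [sortedCol, dif_pos hr, Nat.add_right_cancel_iff, ← Fin.ext_iff] at h
    rw [← h]
    exact S.orderEmbOfFin_mem rfl _
  · intro hi
    have : i ∈ Set.range (S.orderEmbOfFin rfl) := by
      rw [Finset.range_orderEmbOfFin]
      exact hi
    obtain ⟨j, hj⟩ := this
    refine ⟨j.rev, j.rev.isLt, ?_⟩
    rw [sortedCol, dif_pos j.rev.isLt]
    have hrev : Fin.rev ⟨(j.rev : ℕ), j.rev.isLt⟩ = j := Fin.rev_rev j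
    rw [hrev, hj]

/-! ### Cells -/

/-- The height of the `c`-th column of the diagram of `μ`. -/
def colHt (μ : Fin d → ℕ) (c : ℕ) : ℕ := (Finset.univ.filter fun r : Fin d => c < μ r).card

theorem antitone_colHt (μ : Fin d → ℕ) : Antitone (colHt μ) := fun _ _ h =>
  Finset.card_le_card fun r => by
    simp only [Finset.mem_filter, Finset.mem_univ, true_and]
    exact h.trans_lt

theorem colHt_le (μ : Fin d → ℕ) (c : ℕ) : colHt μ c ≤ d :=
  (Finset.card_le_univ _).trans (by simp)

theorem lt_colHt_iff {μ : Fin d → ℕ} (hμ : IsPartitionVec μ) (r : Fin d) (c : ℕ) :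
    (r : ℕ) < colHt μ c ↔ c < μ r := by
  have h : (Finset.univ.filter fun r : Fin d => c < μ r) =
      Finset.univ.filter fun r : Fin d => (r : ℕ) < colHt μ c := by
    refine eq_filter_lt_of_succ_mem fun i j hij hj => ?_
    simp only [Finset.mem_filter, Finset.mem_univ, true_and] at hj ⊢
    exact hj.trans_le (hμ i j (by rw [Fin.le_def]; omega))
  have := Finset.ext_iff.mp h r
  simpa using this.symm

theorem mem_cells_iff {μ : Fin d → ℕ} (hμ : IsPartitionVec μ) (a : ℕ × ℕ) :
    a ∈ cells d μ ↔ a.1 < colHt μ a.2 := by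
  simp only [cells, Finset.mem_filter, Finset.mem_product, Finset.mem_range]
  constructor
  · rintro ⟨_, h, h2⟩
    exact (lt_colHt_iff hμ ⟨a.1, h⟩ a.2).mpr h2
  · intro h
    have hd := h.trans_le (colHt_le μ a.2)
    have h2 := (lt_colHt_iff hμ ⟨a.1, hd⟩ a.2).mp h
    have h3 : μ ⟨a.1, hd⟩ ≤ Finset.univ.sup μ := Finset.le_sup (Finset.mem_univ _)
    exact ⟨⟨hd, by omega⟩, hd, h2⟩

theorem colHt_eq_zero {μ : Fin d → ℕ} {c : ℕ} (hc : Finset.univ.sup μ ≤ c) : colHt μ c = 0 := by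
  rw [colHt, Finset.card_eq_zero, Finset.filter_eq_empty_iff]
  intro r _
  have h3 : μ r ≤ Finset.univ.sup μ := Finset.le_sup (Finset.mem_univ _)
  omega

theorem card_filter_lt_colHt {μ : Fin d → ℕ} (hμ : IsPartitionVec μ) (i : Fin d) :
    ((Finset.range (Finset.univ.sup μ)).filter fun j => (i : ℕ) < colHt μ j).card = μ i := by
  have h : (Finset.range (Finset.univ.sup μ)).filter (fun j => (i : ℕ) < colHt μ j) =
      Finset.range (μ i) := by
    ext j
    have h3 : μ i ≤ Finset.univ.sup μ := Finset.le_sup (Finset.mem_univ _)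
    simp only [lt_colHt_iff hμ, Finset.mem_filter, Finset.mem_range]
    omega
  rw [h, Finset.card_range]

theorem prod_cells {μ : Fin d → ℕ} (hμ : IsPartitionVec μ) {M : Type*} [CommMonoid M]
    (g : ℕ × ℕ → M) :
    ∏ a ∈ cells d μ, g a =
      ∏ c : Fin (Finset.univ.sup μ), ∏ r ∈ Finset.range (colHt μ c), g (r, c) := by
  rw [← Finset.prod_range fun c => ∏ r ∈ Finset.range (colHt μ c), g (r, c)]
  refine Finset.prod_finset_product_right _ _ _ fun a => ?_
  rw [mem_cells_iff hμ, Finset.mem_range, Finset.mem_range]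
  refine ⟨fun h => ⟨?_, h⟩, fun h => h.2⟩
  by_contra! hc
  rw [colHt_eq_zero hc] at h
  omega

theorem sum_cells {μ : Fin d → ℕ} (hμ : IsPartitionVec μ) {M : Type*} [AddCommMonoid M]
    (g : ℕ × ℕ → M) :
    ∑ a ∈ cells d μ, g a =
      ∑ c : Fin (Finset.univ.sup μ), ∑ r ∈ Finset.range (colHt μ c), g (r, c) :=
  Multiplicative.ofAdd.injective
    (prod_cells hμ fun a => Multiplicative.ofAdd (g a))

/-! ### Column sequences of tableaux -/

/-- The values of a reverse tableau of shape `μ`. -/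
structure IsRev (μ : Fin d → ℕ) (val : ℕ × ℕ → ℕ) : Prop where
  mem : ∀ a ∈ cells d μ, 1 ≤ val a ∧ val a ≤ d
  zero : ∀ a ∉ cells d μ, val a = 0
  row : ∀ r c : ℕ, (r, c + 1) ∈ cells d μ → val (r, c + 1) ≤ val (r, c)
  col : ∀ r c : ℕ, (r + 1, c) ∈ cells d μ → val (r + 1, c) < val (r, c)

theorem RevTableau.isRev {μ : Fin d → ℕ} (R : RevTableau d μ) : IsRev μ R.val :=
  ⟨R.mem, R.zero, R.row, R.col⟩

theorem RevBarredTableau.isRev {μ : Fin d → ℕ} (B : RevBarredTableau d μ) : IsRev μ B.val :=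
  ⟨B.mem, B.zero, B.row, B.col⟩

/-- The set of the entries in the `c`-th column. -/
def colSet (μ : Fin d → ℕ) (val : ℕ × ℕ → ℕ) (c : ℕ) : Finset (Fin d) :=
  valSet d (colHt μ c) fun r => val (r, c)

theorem IsRev.isCol {μ : Fin d → ℕ} (hμ : IsPartitionVec μ) {val : ℕ × ℕ → ℕ}
    (hv : IsRev μ val) (c : ℕ) : IsCol d (colHt μ c) fun r => val (r, c) where
  mem r hr := hv.mem _ ((mem_cells_iff hμ _).mpr hr)
  anti r s hrs hs := by
    induction s, hrs using Nat.le_induction with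
    | base => exact hv.col r c ((mem_cells_iff hμ _).mpr hs)
    | succ s _ ih =>
      exact (hv.col s c ((mem_cells_iff hμ _).mpr hs)).trans (ih (by omega))

theorem IsRev.colLE {μ : Fin d → ℕ} (hμ : IsPartitionVec μ) {val : ℕ × ℕ → ℕ}
    (hv : IsRev μ val) (c : ℕ) : ColLE (colSet μ val (c + 1)) (colSet μ val c) :=
  ((hv.isCol hμ (c + 1)).colLE_iff (hv.isCol hμ c) (antitone_colHt μ c.le_succ)).mpr
    fun r hr => hv.row r c ((mem_cells_iff hμ _).mpr hr)

theorem IsRev.ext {μ : Fin d → ℕ} (hμ : IsPartitionVec μ) {v w : ℕ × ℕ → ℕ}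
    (hv : IsRev μ v) (hw : IsRev μ w)
    (h : ∀ c < Finset.univ.sup μ, colSet μ v c = colSet μ w c) : v = w := by
  funext a
  by_cases ha : a ∈ cells d μ
  · have ha' := (mem_cells_iff hμ _).mp ha
    refine (hv.isCol hμ a.2).eq_of_valSet_eq (hw.isCol hμ a.2) (h _ ?_) ha'
    by_contra! hc
    rw [colHt_eq_zero hc] at ha'
    omega
  · rw [hv.zero a ha, hw.zero a ha]

theorem isRev_sortedCol {μ : Fin d → ℕ} (hμ : IsPartitionVec μ) {S : ℕ → Finset (Fin d)}
    (hcard : ∀ c, (S c).card = colHt μ c) (hS : ∀ c, ColLE (S (c + 1)) (S c)) :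
    IsRev μ fun a => sortedCol (S a.2) a.1 where
  mem a ha := by
    rw [mem_cells_iff hμ, ← hcard] at ha
    exact (isCol_sortedCol (S a.2)).mem _ ha
  zero a ha := by
    rw [mem_cells_iff hμ, ← hcard] at ha
    rw [sortedCol, dif_neg ha]
  row r c h := by
    rw [mem_cells_iff hμ, ← hcard] at h
    refine ((isCol_sortedCol (S (c + 1))).colLE_iff (isCol_sortedCol (S c)) ?_).mp ?_ r h
    · rw [hcard, hcard]
      exact antitone_colHt μ c.le_succ
    · rw [valSet_sortedCol, valSet_sortedCol]
      exact hS c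
  col r c h := by
    rw [mem_cells_iff hμ, ← hcard] at h
    exact (isCol_sortedCol (S c)).anti r (r + 1) r.lt_succ_self h

theorem colSet_sortedCol {μ : Fin d → ℕ} {S : ℕ → Finset (Fin d)}
    (hcard : ∀ c, (S c).card = colHt μ c) (c : ℕ) :
    colSet μ (fun a => sortedCol (S a.2) a.1) c = S c := by
  rw [colSet, ← hcard, valSet_sortedCol]

/-- `S` is the sequence of entry sets of the columns `c, …, c + n - 1` of a tableau. -/
def Chain (h : ℕ → ℕ) {n : ℕ} (c : ℕ) (b : Finset (Fin d)) (S : Fin n → Finset (Fin d)) : Prop :=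
  (∀ i : Fin n, (S i).card = h (c + i)) ∧ (∀ i : Fin n, (i : ℕ) = 0 → ColLE (S i) b) ∧
    ∀ i j : Fin n, (j : ℕ) = i + 1 → ColLE (S j) (S i)

theorem chain_succ_iff (h : ℕ → ℕ) {n : ℕ} (c : ℕ) (b : Finset (Fin d))
    (S : Fin (n + 1) → Finset (Fin d)) :
    Chain h c b S ↔
      ((S 0).card = h c ∧ ColLE (S 0) b) ∧ Chain h (c + 1) (S 0) fun i => S i.succ := by
  unfold Chain
  constructor
  · rintro ⟨h1, h2, h3⟩
    refine ⟨⟨by simpa using h1 0, h2 0 rfl⟩, fun i => ?_, fun i hi => h3 0 i.succ (by simp [hi]),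
      fun i j hij => h3 i.succ j.succ (by simp [hij])⟩
    rw [h1, Fin.val_succ, add_assoc, add_comm 1]
  · rintro ⟨⟨h1, h2⟩, h3, h4, h5⟩
    refine ⟨fun i => ?_, fun i hi => ?_, fun i j hij => ?_⟩
    · refine Fin.cases (by simpa using h1) (fun i => ?_) i
      rw [h3, Fin.val_succ, add_assoc, add_comm 1]
    · have : i = 0 := Fin.ext hi
      rwa [this]
    · induction j using Fin.cases with
      | zero => simp at hij
      | succ j =>
        induction i using Fin.cases with
        | zero => exact h4 j (by simpa using hij)
        | succ i => exact h5 i j (by simpa using hij)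

theorem sum_pi_succ {α M : Type*} [Fintype α] [AddCommMonoid M] {n : ℕ}
    (g : (Fin (n + 1) → α) → M) :
    ∑ f, g f = ∑ a, ∑ f : Fin n → α, g (Fin.cons a f) := by
  rw [← (Fin.consEquiv fun _ => α).sum_comp, Fintype.sum_prod_type]
  rfl

theorem colSum_eq_sum (h : ℕ → ℕ) (n c : ℕ) (b : Finset (Fin d)) :
    colSum h n c b = ∑ S : Fin n → Finset (Fin d),
      if Chain h c b S then ∏ i : Fin n, colWt (c + i) (S i) else 0 := by
  induction n generalizing c b with
  | zero => simp [colSum, Chain]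
  | succ n ih =>
    rw [sum_pi_succ, colSum]
    refine Finset.sum_congr rfl fun S _ => ?_
    simp only [chain_succ_iff, Fin.cons_zero, Fin.cons_succ]
    split_ifs with hS
    · simp only [hS, true_and]
      rw [ih, Finset.mul_sum]
      refine Finset.sum_congr rfl fun f _ => ?_
      rw [mul_ite, mul_zero, Fin.prod_univ_succ]
      simp only [Fin.cons_zero, Fin.cons_succ, Fin.val_zero, add_zero, Fin.val_succ, add_assoc,
        add_comm 1]
    · simp [hS]

/-- Extension of a finite sequence by empty sets. -/
def extend {n : ℕ} (S : Fin n → Finset (Fin d)) (c : ℕ) : Finset (Fin d) :=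
  if h : c < n then S ⟨c, h⟩ else ∅

theorem extend_coe {n : ℕ} (S : Fin n → Finset (Fin d)) (i : Fin n) : extend S i = S i := by
  simp [extend]

theorem colLE_univ (S : Finset (Fin d)) : ColLE S Finset.univ := fun _ =>
  Finset.card_le_card (Finset.filter_subset_filter _ (Finset.subset_univ _))

theorem Chain.card_extend {μ : Fin d → ℕ} {b : Finset (Fin d)}
    {S : Fin (Finset.univ.sup μ) → Finset (Fin d)} (h : Chain (colHt μ) 0 b S) (c : ℕ) :
    (extend S c).card = colHt μ c := by
  unfold extend
  split_ifs with hc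
  · simpa using h.1 ⟨c, hc⟩
  · rw [colHt_eq_zero (by omega), Finset.card_empty]

theorem Chain.colLE_extend {μ : Fin d → ℕ} {b : Finset (Fin d)}
    {S : Fin (Finset.univ.sup μ) → Finset (Fin d)} (h : Chain (colHt μ) 0 b S) (c : ℕ) :
    ColLE (extend S (c + 1)) (extend S c) := by
  unfold extend
  split_ifs with h1 h2
  · exact h.2.2 _ _ rfl
  · omega
  · exact fun v => by simp [cnt]
  · exact fun v => by simp [cnt]

theorem IsRev.chain {μ : Fin d → ℕ} (hμ : IsPartitionVec μ) {val : ℕ × ℕ → ℕ}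
    (hv : IsRev μ val) :
    Chain (colHt μ) 0 Finset.univ
      fun i : Fin (Finset.univ.sup μ) => colSet μ val i := by
  refine ⟨fun i => ?_, fun i _ => colLE_univ _, fun i j hij => ?_⟩
  · rw [zero_add]
    exact (hv.isCol hμ i).card_valSet
  · show ColLE (colSet μ val j) (colSet μ val i)
    rw [hij]
    exact hv.colLE hμ i

theorem fSchur_eq_colSum {μ : Fin d → ℕ} (hμ : IsPartitionVec μ) :
    fSchur d μ = colSum (colHt μ) (Finset.univ.sup μ) 0 Finset.univ := by
  rw [colSum_eq_sum, ← Finset.sum_filter, ← finsum_mem_coe_finset, fSchur, ← finsum_mem_univ]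
  refine finsum_mem_eq_of_bijOn (fun R i => colSet μ R.val i) ⟨?_, ?_, ?_⟩ ?_
  · intro R _
    simpa using R.isRev.chain hμ
  · intro R _ R' _ h
    have h1 : R.val = R'.val :=
      R.isRev.ext hμ R'.isRev fun c hc => congrFun h ⟨c, hc⟩
    cases R
    cases R'
    simpa using h1
  · intro S hS
    have hS' : Chain (colHt μ) 0 Finset.univ S := by simpa using hS
    have hrev := isRev_sortedCol hμ hS'.card_extend hS'.colLE_extend
    refine ⟨⟨_, hrev.mem, hrev.zero, hrev.row, hrev.col⟩, trivial, ?_⟩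
    funext i
    exact (colSet_sortedCol hS'.card_extend i).trans (extend_coe S i)
  · intro R _
    rw [prod_cells hμ]
    refine Finset.prod_congr rfl fun c _ => ?_
    rw [(R.isRev.isCol hμ c).prod_eq_rank fun r v => factor d v (r, (c : ℕ)), colWt]
    refine Finset.prod_congr rfl fun i _ => ?_
    rw [colFactor, factor, xv, dif_pos (by simp)]
    simp only [Nat.add_sub_cancel, Fin.eta, zero_add, colSet]
    congr 2
    push_cast
    ring

theorem aDet_rho_mul_fSchur {μ : Fin d → ℕ} (hμ : IsPartitionVec μ) :
    aDet d (rho d) * fSchur d μ = aDet d fun i => μ i + rho d i := by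
  rw [fSchur_eq_colSum hμ, aDet_rho_mul_colSum (antitone_colHt μ) (colHt_le μ 0)]
  simp only [card_filter_lt_colHt hμ, add_comm]

end Tableaux

/-! ### Column sequences of barred tableaux -/

section Barred

variable {d : ℕ}

/-- The vector `ξ` plus the content of the unbarred parts of the first `k` columns. -/
def partialContent {n : ℕ} (ξ : Fin d → ℕ) (p : Fin n → Finset (Fin d) × Finset (Fin d)) (k : ℕ) :
    Fin d → ℕ :=
  fun v => ξ v + ∑ j : Fin n, if (j : ℕ) < k ∧ v ∈ (p j).2 then 1 else 0

theorem partialContent_zero {n : ℕ} (ξ : Fin d → ℕ) (p : Fin n → Finset (Fin d) × Finset (Fin d)) :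
    partialContent ξ p 0 = ξ := by
  funext v
  simp [partialContent]

theorem partialContent_succ {n : ℕ} (ξ : Fin d → ℕ)
    (p : Fin (n + 1) → Finset (Fin d) × Finset (Fin d)) (k : ℕ) :
    partialContent ξ p (k + 1) =
      partialContent (addInd ξ (p 0).2) (fun i => p i.succ) k := by
  funext v
  simp only [partialContent, addInd, Fin.sum_univ_succ, Fin.val_zero, Fin.val_succ,
    Nat.succ_pos, true_and, Nat.add_lt_add_iff_right, add_assoc]

/-- `p` lists the sets of all entries and of unbarred entries of the columns
`c, …, c + n - 1` of a barred tableau all of whose column prefixes keep `ξ` strictly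
decreasing. -/
def YamChain (h : ℕ → ℕ) {n : ℕ} (c : ℕ) (b : Finset (Fin d)) (ξ : Fin d → ℕ)
    (p : Fin n → Finset (Fin d) × Finset (Fin d)) : Prop :=
  Chain h c b (fun i => (p i).1) ∧ (∀ i, (p i).2 ⊆ (p i).1) ∧
    ∀ k ≤ n, Strict (partialContent ξ p k)

theorem yamChain_succ_iff (h : ℕ → ℕ) {n : ℕ} (c : ℕ) (b : Finset (Fin d)) {ξ : Fin d → ℕ}
    (hξ : Strict ξ) (p : Fin (n + 1) → Finset (Fin d) × Finset (Fin d)) :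
    YamChain h c b ξ p ↔ (BarredColOK h c b (p 0) ∧ Strict (addInd ξ (p 0).2)) ∧
      YamChain h (c + 1) (p 0).1 (addInd ξ (p 0).2) fun i => p i.succ := by
  unfold YamChain BarredColOK
  rw [chain_succ_iff]
  constructor
  · rintro ⟨⟨⟨h1, h2⟩, h3⟩, h4, h5⟩
    refine ⟨⟨⟨h1, h2, h4 0⟩, ?_⟩, h3, fun i => h4 i.succ, fun k hk => ?_⟩
    · have := h5 1 (by omega)
      rwa [partialContent_succ, partialContent_zero] at this
    · have := h5 (k + 1) (by omega)
      rwa [partialContent_succ] at this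
  · rintro ⟨⟨⟨h1, h2, h4⟩, _⟩, h3, h6, h7⟩
    refine ⟨⟨⟨h1, h2⟩, h3⟩, fun i => Fin.cases h4 h6 i, fun k hk => ?_⟩
    cases k with
    | zero => rwa [partialContent_zero]
    | succ k =>
      rw [partialContent_succ]
      exact h7 k (by omega)

theorem yamSum_eq_sum (h : ℕ → ℕ) (n c : ℕ) (b : Finset (Fin d)) {ξ : Fin d → ℕ}
    (hξ : Strict ξ) :
    yamSum h n c b ξ = ∑ p : Fin n → Finset (Fin d) × Finset (Fin d),
      if YamChain h c b ξ p then
        (∏ i : Fin n, colCoef (c + i) (partialContent ξ p i) (p i).1 (p i).2) *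
          aDet d (partialContent ξ p n) else 0 := by
  induction n generalizing c b ξ with
  | zero =>
    have : ∀ p : Fin 0 → Finset (Fin d) × Finset (Fin d), YamChain h c b ξ p := fun p =>
      ⟨⟨fun i => i.elim0, fun i => i.elim0, fun i => i.elim0⟩, fun i => i.elim0, fun k hk => by
        obtain rfl : k = 0 := by omega
        rwa [partialContent_zero]⟩
    simp [yamSum, this, partialContent_zero]
  | succ n ih =>
    rw [sum_pi_succ, yamSum]
    refine Finset.sum_congr rfl fun q _ => ?_
    simp only [yamChain_succ_iff h c b hξ, Fin.cons_zero, Fin.cons_succ]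
    split_ifs with hq
    · simp only [hq, true_and]
      rw [ih _ _ hq.2, Finset.mul_sum]
      refine Finset.sum_congr rfl fun f _ => ?_
      rw [mul_ite, mul_zero, Fin.prod_univ_succ]
      simp only [Fin.cons_zero, Fin.cons_succ, Fin.val_zero, add_zero, Fin.val_succ,
        partialContent_succ, partialContent_zero, mul_assoc, add_assoc, add_comm 1]
    · simp [hq]

variable {μ : Fin d → ℕ}

/-- The set of the unbarred entries in the `c`-th column. -/
def unbarredSet (B : RevBarredTableau d μ) (c : ℕ) : Finset (Fin d) :=
  (colSet μ B.val c).filter fun i => ¬ B.barred (cnt (colSet μ B.val c) (i + 1), c)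

theorem mem_unbarredSet {B : RevBarredTableau d μ} {c : ℕ} {i : Fin d} :
    i ∈ unbarredSet B c ↔
      i ∈ colSet μ B.val c ∧ ¬ B.barred (cnt (colSet μ B.val c) (i + 1), c) := by
  rw [unbarredSet, Finset.mem_filter]

/-- The sets of all entries and of unbarred entries of each column. -/
def columns (B : RevBarredTableau d μ) (c : Fin (Finset.univ.sup μ)) :
    Finset (Fin d) × Finset (Fin d) :=
  (colSet μ B.val c, unbarredSet B c)

theorem card_filter_cells (hμ : IsPartitionVec μ) (B : RevBarredTableau d μ) (i : Fin d)
    (Q : ℕ × ℕ → Prop) :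
    ((cells d μ).filter fun b => ¬ B.barred b ∧ B.val b = i + 1 ∧ Q b).card =
      ∑ c : Fin (Finset.univ.sup μ),
        if i ∈ unbarredSet B c ∧ Q (cnt (colSet μ B.val c) (i + 1), c) then 1 else 0 := by
  rw [Finset.card_filter, sum_cells hμ]
  refine Finset.sum_congr rfl fun c _ => ?_
  rw [(B.isRev.isCol hμ c).sum_eq_rank fun r w =>
    if ¬ B.barred (r, (c : ℕ)) ∧ w = i + 1 ∧ Q (r, c) then 1 else 0]
  change ∑ j ∈ colSet μ B.val c, (if ¬ B.barred (cnt (colSet μ B.val c) (j + 1), (c : ℕ)) ∧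
    (j : ℕ) + 1 = i + 1 ∧ Q (cnt (colSet μ B.val c) (j + 1), c) then 1 else 0) = _
  simp only [mem_unbarredSet]
  by_cases hi : i ∈ colSet μ B.val c
  · rw [Finset.sum_eq_single_of_mem i hi]
    · simp [hi]
    · intro j _ hj
      rw [if_neg]
      rintro ⟨_, h, _⟩
      exact hj (Fin.ext (by omega))
  · rw [if_neg fun h => hi h.1.1]
    refine Finset.sum_eq_zero fun j hj => if_neg ?_
    rintro ⟨_, h, _⟩
    have : j = i := Fin.ext (by omega)
    exact hi (this ▸ hj)

theorem add_content (hμ : IsPartitionVec μ) (B : RevBarredTableau d μ) (ξ : Fin d → ℕ)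
    (i : Fin d) :
    ξ i + B.content (i + 1) = partialContent ξ (columns B) (Finset.univ.sup μ) i := by
  have h := card_filter_cells hμ B i fun _ => True
  simp only [and_true] at h
  rw [RevBarredTableau.content, h, partialContent]
  congr 1
  exact Finset.sum_congr rfl fun c _ => if_congr (by simp only [columns, Fin.is_lt, true_and]) rfl rfl

theorem add_countBefore (hμ : IsPartitionVec μ) (B : RevBarredTableau d μ) (ξ : Fin d → ℕ)
    (c : ℕ) (i : Fin d) :
    ξ i + B.countBefore (cnt (colSet μ B.val c) (i + 1), c) (i + 1) =
      partialContent ξ (columns B) c i := by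
  rw [RevBarredTableau.countBefore, card_filter_cells hμ, partialContent]
  congr 1
  refine Finset.sum_congr rfl fun j _ => ?_
  refine if_congr ?_ rfl rfl
  simp only [revBefore, columns]
  constructor
  · rintro ⟨h1, h2 | ⟨h2, h3⟩⟩
    · exact ⟨h2, h1⟩
    · rw [h2] at h3
      omega
  · rintro ⟨h1, h2⟩
    exact ⟨h2, Or.inl h1⟩

theorem partialContent_succ_eq {n : ℕ} (ξ : Fin d → ℕ)
    (p : Fin n → Finset (Fin d) × Finset (Fin d)) (c : Fin n) (i : Fin d) :
    partialContent ξ p (c + 1) i =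
      partialContent ξ p c i + if i ∈ (p c).2 then 1 else 0 := by
  have h : (if i ∈ (p c).2 then 1 else 0) =
      ∑ j : Fin n, if j = c then (if i ∈ (p c).2 then 1 else 0) else 0 := by simp
  rw [partialContent, partialContent, h, add_assoc, ← Finset.sum_add_distrib]
  congr 1
  refine Finset.sum_congr rfl fun j _ => ?_
  rcases lt_trichotomy (j : ℕ) c with h | h | h
  · have : j ≠ c := fun h' => by rw [h'] at h; omega
    simp [this, h, h.trans (Nat.lt_succ_self _)]
  · have : j = c := Fin.ext h
    subst this
    simp
  · have h1 : j ≠ c := fun h' => by rw [h'] at h; omega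
    have h2 : ¬ (j : ℕ) < c := by omega
    have h3 : ¬ (j : ℕ) < c + 1 := by omega
    simp [h1, h2, h3]

theorem partialContent_columns_succ (B : RevBarredTableau d μ) (ξ : Fin d → ℕ) {c : ℕ}
    (hc : c < Finset.univ.sup μ) (i : Fin d) :
    partialContent ξ (columns B) (c + 1) i =
      partialContent ξ (columns B) c i + if i ∈ unbarredSet B c then 1 else 0 :=
  partialContent_succ_eq ξ (columns B) ⟨c, hc⟩ i

theorem add_countUpTo (hμ : IsPartitionVec μ) (B : RevBarredTableau d μ) (ξ : Fin d → ℕ)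
    (r : ℕ) {c : ℕ} (hc : c < Finset.univ.sup μ) (i : Fin d) :
    ξ i + B.countUpTo (r, c) (i + 1) = partialContent ξ (columns B) c i +
      if r ≤ cnt (colSet μ B.val c) (i + 1) then
        (if i ∈ unbarredSet B c then 1 else 0) else 0 := by
  have hcount : B.countUpTo (r, c) (i + 1) = _ :=
    Eq.trans (by rw [RevBarredTableau.countUpTo]; congr!)
      (card_filter_cells hμ B i fun b => revBefore (r, c) b ∨ b = (r, c))
  have h : (if r ≤ cnt (colSet μ B.val c) (i + 1) then
        (if i ∈ unbarredSet B c then 1 else 0) else 0) =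
      ∑ j : Fin (Finset.univ.sup μ), if j = ⟨c, hc⟩ then
        (if r ≤ cnt (colSet μ B.val c) (i + 1) then
          (if i ∈ unbarredSet B c then 1 else 0) else 0) else 0 := by
    simp only [Finset.sum_ite_eq', Finset.mem_univ, if_true]
  rw [hcount, partialContent, h, add_assoc, ← Finset.sum_add_distrib]
  congr 1
  refine Finset.sum_congr rfl fun j _ => ?_
  simp only [revBefore, columns, Prod.mk.injEq, Fin.ext_iff]
  rcases lt_trichotomy (j : ℕ) c with h | h | h
  · simp [h, h.ne]
  · subst h
    by_cases h1 : i ∈ unbarredSet B j <;>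
      simp [h1, le_iff_lt_or_eq, eq_comm]
  · simp [h.ne', h.not_gt]

theorem vecAt_succ (ξ : Fin d → ℕ) (i : Fin d) : vecAt ξ (i + 1) = ξ i := by
  simp [vecAt]

theorem cXi_eq_prod (hμ : IsPartitionVec μ) (B : RevBarredTableau d μ) (ξ : Fin d → ℕ) :
    B.cXi (fun i => ξ i + 1) = ∏ c : Fin (Finset.univ.sup μ),
      colCoef c (partialContent ξ (columns B) c) (columns B c).1 (columns B c).2 := by
  rw [RevBarredTableau.cXi, Finset.prod_filter, prod_cells hμ]
  refine Finset.prod_congr rfl fun c _ => ?_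
  refine ((B.isRev.isCol hμ c).prod_eq_rank fun r w => if B.barred (r, (c : ℕ)) then
    yI d ((vecAt (fun i => ξ i + 1) w : ℤ) + (B.countBefore (r, c) w : ℤ)) -
    yI d ((d : ℤ) + 1 - (w : ℤ) + (c : ℤ) - (r : ℤ)) else 1).trans ?_
  rw [colCoef]
  change ∏ i ∈ colSet μ B.val c, _ = ∏ i ∈ colSet μ B.val c \ unbarredSet B c, _
  have h2 : colSet μ B.val c \ unbarredSet B c =
      (colSet μ B.val c).filter fun i : Fin d => B.barred (cnt (colSet μ B.val c) (i + 1), c) := by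
    ext i
    simp only [Finset.mem_sdiff, mem_unbarredSet, Finset.mem_filter]
    tauto
  rw [h2, Finset.prod_filter]
  refine Finset.prod_congr rfl fun i _ => ?_
  change (if B.barred (cnt (colSet μ B.val c) (i + 1), (c : ℕ)) then
    yI d ((vecAt (fun i => ξ i + 1) (i + 1) : ℤ) +
      (B.countBefore (cnt (colSet μ B.val c) (i + 1), c) (i + 1) : ℤ)) -
    yI d ((d : ℤ) + 1 - ((i + 1 : ℕ) : ℤ) + (c : ℤ) -
      (cnt (colSet μ B.val c) (i + 1) : ℤ)) else 1) = _
  rw [vecAt_succ, ← add_countBefore hμ B ξ c i]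
  simp only [columns]
  refine if_congr Iff.rfl ?_ rfl
  congr 2
  · push_cast
    ring
  · push_cast
    ring

theorem mem_cells_of_mem_colSet (hμ : IsPartitionVec μ) {val : ℕ × ℕ → ℕ} (hv : IsRev μ val)
    {c : ℕ} {i : Fin d} (hi : i ∈ colSet μ val c) :
    (cnt (colSet μ val c) (i + 1), c) ∈ cells d μ := by
  rw [mem_cells_iff hμ]
  simp only [colSet, valSet, Finset.mem_filter, Finset.mem_univ, true_and] at hi
  obtain ⟨r, hr, h⟩ := hi
  simp only
  rw [← h, colSet, (hv.isCol hμ c).cnt_val hr]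
  exact hr

theorem cnt_antitone (S : Finset (Fin d)) : Antitone (cnt S) := fun a b hab =>
  Finset.card_le_card fun j => by
    simp only [Finset.mem_filter]
    exact fun h => ⟨h.1, hab.trans h.2⟩

theorem starYam_iff (hμ : IsPartitionVec μ) (B : RevBarredTableau d μ) {lam : Fin d → ℕ}
    (hlam : Strict fun i => lam i + rho d i) :
    B.StarYam lam ↔ ∀ k ≤ Finset.univ.sup μ,
      Strict (partialContent (fun i => lam i + rho d i) (columns B) k) := by
  have hpc : ∀ k i, partialContent (fun i => lam i + rho d i) (columns B) k i =
      partialContent lam (columns B) k i + rho d i := fun k i => by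
    simp only [partialContent]
    ring
  have hrho : ∀ i j : Fin d, (j : ℕ) = i + 1 → rho d i = rho d j + 1 := fun i j hij => by
    unfold rho
    omega
  constructor
  · intro H k
    induction k with
    | zero => exact fun _ => by rwa [partialContent_zero]
    | succ k ih =>
      intro hk i j hij
      have h0 := ih (by omega) i j hij
      have h1 := hrho i j hij
      rw [hpc, hpc] at h0 ⊢
      have hi := partialContent_columns_succ B lam hk i
      have hj := partialContent_columns_succ B lam hk j
      by_cases hjT : j ∈ unbarredSet B k
      · have hjT' := mem_unbarredSet.mp hjT
        have h2 := H (cnt (colSet μ B.val k) (j + 1), k)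
          (mem_cells_of_mem_colSet hμ B.isRev hjT'.1) hjT'.2 (i + 1) (by omega)
        have h3 := add_countUpTo hμ B lam (cnt (colSet μ B.val k) (j + 1)) hk i
        have h4 := add_countUpTo hμ B lam (cnt (colSet μ B.val k) (j + 1)) hk j
        have h5 : cnt (colSet μ B.val k) (j + 1) ≤ cnt (colSet μ B.val k) (i + 1) :=
          cnt_antitone _ (by omega)
        rw [if_pos h5] at h3
        rw [if_pos le_rfl] at h4
        rw [show (i : ℕ) + 1 + 1 = j + 1 by omega, vecAt_succ, vecAt_succ] at h2
        omega
      · rw [if_neg hjT] at hj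
        omega
  · rintro H ⟨r, c⟩ ha hb k hk
    have hc : c < Finset.univ.sup μ := by
      rw [mem_cells_iff hμ] at ha
      by_contra! hc
      rw [colHt_eq_zero hc] at ha
      omega
    by_cases hkd : k < d
    · obtain ⟨i, rfl⟩ : ∃ i : Fin d, k = i + 1 := ⟨⟨k - 1, by omega⟩, by simp only; omega⟩
      set j : Fin d := ⟨i + 1, hkd⟩ with hj
      have hij : (j : ℕ) = i + 1 := rfl
      have h1 := hrho i j hij
      have h3 := add_countUpTo hμ B lam r hc i
      have h4 := add_countUpTo hμ B lam r hc j
      rw [vecAt_succ, ← hij, vecAt_succ, h3, h4]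
      have hi := partialContent_columns_succ B lam hc i
      have hj := partialContent_columns_succ B lam hc j
      have h5 : cnt (colSet μ B.val c) (j + 1) ≤ cnt (colSet μ B.val c) (i + 1) :=
        cnt_antitone _ (by omega)
      have h6 := H c hc.le i j hij
      have h7 := H (c + 1) hc i j hij
      rw [hpc, hpc] at h6 h7
      by_cases hr : r ≤ cnt (colSet μ B.val c) (j + 1)
      · rw [if_pos hr, if_pos (hr.trans h5)]
        omega
      · rw [if_neg hr]
        omega
    · have h0 : vecAt lam (k + 1) = 0 := by
        rw [vecAt, dif_neg (by omega)]
      have h1 : B.countUpTo (r, c) (k + 1) = 0 := by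
        rw [RevBarredTableau.countUpTo, Finset.card_eq_zero, Finset.filter_eq_empty_iff]
        rintro b hb ⟨_, h, _⟩
        have := (B.mem b hb).2
        omega
      omega

theorem isPartitionVec_of_strict {ν : Fin d → ℕ} (h : Strict fun i => ν i + rho d i) :
    IsPartitionVec ν := by
  have h1 : ∀ i j : Fin d, (j : ℕ) = i + 1 → ν j ≤ ν i := fun i j hij => by
    have := h i j hij
    simp only [rho] at this
    omega
  intro i j hij
  obtain ⟨j, hj⟩ := j
  rw [Fin.le_def] at hij
  simp only at hij
  induction j, hij using Nat.le_induction with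
  | base => exact le_rfl
  | succ j hij ih => exact (h1 ⟨j, by omega⟩ ⟨j + 1, hj⟩ rfl).trans (ih (by omega))

theorem IsPartitionVec.strict {ν : Fin d → ℕ} (h : IsPartitionVec ν) :
    Strict fun i => ν i + rho d i := fun i j hij => by
  have h1 := h i j (by rw [Fin.le_def]; omega)
  have h2 := strict_rho i j hij
  simp only
  omega

theorem barred_iff (hμ : IsPartitionVec μ) (B : RevBarredTableau d μ) (a : ℕ × ℕ) :
    B.barred a ↔ ∃ i ∈ colSet μ B.val a.2, i ∉ unbarredSet B a.2 ∧
      cnt (colSet μ B.val a.2) (i + 1) = a.1 := by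
  constructor
  · intro h
    have ha := (mem_cells_iff hμ a).mp (B.barred_sub a h)
    have hm := (B.isRev.isCol hμ a.2).mem a.1 ha
    have hr := (B.isRev.isCol hμ a.2).cnt_val ha
    refine ⟨⟨B.val a - 1, ?_⟩, ?_, ?_, ?_⟩
    · simp only [Prod.mk.eta] at hm
      omega
    · simp only [colSet, valSet, Finset.mem_filter, Finset.mem_univ, true_and]
      exact ⟨a.1, ha, by simp only [Prod.mk.eta] at hm ⊢; omega⟩
    all_goals
      simp only [Prod.mk.eta] at hm hr
      have he : B.val a - 1 + 1 = B.val a := by omega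
    · rw [mem_unbarredSet]
      simp only [he, not_and, not_not]
      intro _
      rw [colSet, hr]
      exact h
    · simp only [he]
      exact hr
  · rintro ⟨i, hi, hi2, hi3⟩
    rw [mem_unbarredSet] at hi2
    push Not at hi2
    have := hi2 hi
    rwa [hi3] at this

theorem columns_injective (hμ : IsPartitionVec μ) :
    Function.Injective (columns : RevBarredTableau d μ → _) := by
  intro B B' h
  have hval : B.val = B'.val :=
    B.isRev.ext hμ B'.isRev fun c hc => congrArg Prod.fst (congrFun h ⟨c, hc⟩)
  have hbar : B.barred = B'.barred := by
    funext a
    by_cases hc : a.2 < Finset.univ.sup μ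
    · have hT : unbarredSet B a.2 = unbarredSet B' a.2 :=
        congrArg Prod.snd (congrFun h ⟨a.2, hc⟩)
      rw [eq_iff_iff, barred_iff hμ, barred_iff hμ, hT, hval]
    · have ha : a ∉ cells d μ := by
        rw [mem_cells_iff hμ, colHt_eq_zero (by omega)]
        omega
      rw [eq_iff_iff]
      exact ⟨fun h => absurd (B.barred_sub a h) ha, fun h => absurd (B'.barred_sub a h) ha⟩
  cases B
  cases B'
  simp only at hval hbar
  subst hval hbar
  rfl

theorem exists_columns_eq (hμ : IsPartitionVec μ) {b : Finset (Fin d)}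
    {p : Fin (Finset.univ.sup μ) → Finset (Fin d) × Finset (Fin d)}
    (h1 : Chain (colHt μ) 0 b fun i => (p i).1) (h2 : ∀ i, (p i).2 ⊆ (p i).1) :
    ∃ B : RevBarredTableau d μ, columns B = p := by
  set S := extend fun i => (p i).1 with hS
  set T := extend fun i => (p i).2 with hT
  have hrev := isRev_sortedCol hμ h1.card_extend h1.colLE_extend
  have hcol := colSet_sortedCol h1.card_extend
  refine ⟨⟨fun a => sortedCol (S a.2) a.1,
    fun a => a ∈ cells d μ ∧ ∃ i ∈ S a.2, i ∉ T a.2 ∧ cnt (S a.2) (i + 1) = a.1,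
    hrev.mem, hrev.zero, fun a h => h.1, hrev.row, hrev.col⟩, ?_⟩
  funext c
  have hSc : S c = (p c).1 := extend_coe _ c
  have hTc : T c = (p c).2 := extend_coe _ c
  refine Prod.ext ((hcol c).trans hSc) ?_
  ext i
  rw [columns, mem_unbarredSet]
  rw [show colSet μ (fun a => sortedCol (S a.2) a.1) c = S c from hcol c]
  have hTS := h2 c
  rw [← hSc, ← hTc] at *
  constructor
  · rintro ⟨hi, hb⟩
    by_contra hiT
    refine hb ⟨?_, i, hi, hiT, rfl⟩
    have := mem_cells_of_mem_colSet hμ hrev (c := c) (i := i) (by rw [hcol]; exact hi)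
    rwa [hcol] at this
  · intro hi
    refine ⟨hTS hi, ?_⟩
    rintro ⟨_, j, hj, hjT, hc⟩
    have hij : j = i := by
      change cnt (S c) (j + 1) = cnt (S c) (i + 1) at hc
      by_contra hne
      have hiS := hTS hi
      rcases lt_or_gt_of_ne hne with h | h
      · have h3 := cnt_eq_cnt_succ (S c) i
        rw [if_pos hiS] at h3
        have h4 : cnt (S c) i ≤ cnt (S c) (j + 1) := cnt_antitone _ h
        omega
      · have h3 := cnt_eq_cnt_succ (S c) j
        rw [if_pos hj] at h3
        have h4 : cnt (S c) j ≤ cnt (S c) (i + 1) := cnt_antitone _ h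
        omega
    exact hjT (hij ▸ hi)

theorem bijOn_columns (hμ : IsPartitionVec μ) {lam : Fin d → ℕ} (hlam : IsPartitionVec lam) :
    Set.BijOn (columns : RevBarredTableau d μ → _) {B | B.StarYam lam}
      {p | YamChain (colHt μ) 0 Finset.univ (fun i => lam i + rho d i) p} := by
  refine ⟨fun B hB => ?_, (columns_injective hμ).injOn, fun p hp => ?_⟩
  · exact ⟨B.isRev.chain hμ, fun i => Finset.filter_subset _ _,
      (starYam_iff hμ B hlam.strict).mp hB⟩
  · obtain ⟨h1, h2, h3⟩ := hp
    obtain ⟨B, rfl⟩ := exists_columns_eq hμ h1 h2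
    exact ⟨B, (starYam_iff hμ B hlam.strict).mpr h3, rfl⟩

end Barred

/-- Littlewood–Richardson rule for factorial Schur functions:
`s_λ(x|y)·s_μ(x|y) = Σ c_{λ*B} · s_{λ+ω(B^u)}(x|y)`, summed over reverse barred tableaux
`B` of shape `μ` whose word `(λ*B)^u` is Yamanouchi. -/
theorem factorial_LR_rule (d : ℕ) (hd : 1 ≤ d)
    (lam mu : Fin d → ℕ) (hlam : IsPartitionVec lam) (hmu : IsPartitionVec mu) :
    fSchur d lam * fSchur d mu =
      ∑ᶠ B ∈ {B : RevBarredTableau d mu | B.StarYam lam},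
        B.cXi (fun i => lam i + rho d i + 1) *
          fSchur d (fun i => lam i + B.content ((i : ℕ) + 1)) := by
  set ξ : Fin d → ℕ := fun i => lam i + rho d i with hξ
  refine mul_left_cancel₀ (aDet_rho_ne_zero (d := d)) ?_
  rw [← mul_assoc, aDet_rho_mul_fSchur hlam, fSchur_eq_colSum hmu,
    aDet_mul_colSum_univ _ _ hlam.strict, yamSum_eq_sum _ _ _ _ hlam.strict]
  have key : ∀ p, YamChain (colHt mu) 0 Finset.univ ξ p →
      (∏ i : Fin (Finset.univ.sup mu),
        colCoef (0 + i) (partialContent ξ p i) (p i).1 (p i).2) *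
          aDet d (partialContent ξ p (Finset.univ.sup mu)) =
      aDet d (rho d) * ((∏ i : Fin (Finset.univ.sup mu),
        colCoef i (partialContent ξ p i) (p i).1 (p i).2) *
          fSchur d (partialContent lam p (Finset.univ.sup mu))) := by
    intro p hp
    have h1 : (fun i => partialContent lam p (Finset.univ.sup mu) i + rho d i) =
        partialContent ξ p (Finset.univ.sup mu) := by
      funext i
      simp only [partialContent, hξ]
      ring
    have h2 := hp.2.2 _ le_rfl
    rw [← h1] at h2
    rw [mul_left_comm, aDet_rho_mul_fSchur (isPartitionVec_of_strict h2), h1]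
    simp only [zero_add]
  rw [Finset.sum_congr rfl fun p _ => show _ = if YamChain (colHt mu) 0 Finset.univ ξ p then
      aDet d (rho d) * ((∏ i : Fin (Finset.univ.sup mu),
        colCoef i (partialContent ξ p i) (p i).1 (p i).2) *
          fSchur d (partialContent lam p (Finset.univ.sup mu))) else 0 from by
    split_ifs with hp
    · exact key p hp
    · rfl]
  rw [← Finset.sum_filter, ← Finset.mul_sum, ← finsum_mem_coe_finset]
  congr 1
  symm
  refine finsum_mem_eq_of_bijOn columns ?_ ?_
  · simpa using bijOn_columns hmu hlam
  · intro B _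
    rw [cXi_eq_prod hmu B ξ]
    congr 2
    funext i
    exact add_content hmu B lam i

end EqLR
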